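/- Fix δ₀ ∈ (0,1). For the Anderson–Bernoulli model at disorder λ > 0, for every s < 1 there exists λ₀ > 0 such that for all 0 < λ < λ₀: for every E with δ₀ < |E| < 2 − δ₀ the limit 𝒩_λ(E) = lim_{N→∞} (1/N) 𝔼_ε[ #{ j : the j-th eigenvalue of H_N(ε) is ≤ E } ] defining the integrated density of states exists, and there is a constant C such that |𝒩_λ(E) − 𝒩_λ(E')| ≤ C |E − E'|^s for all E, E' with δ₀ < |E|, |E'| < 2 − δ₀ lying in the same component of {δ₀ < |x| < 2 − δ₀}. In other words, the IDS of the Anderson–Bernoulli model is s-Hölder regular on this energy region, with s → 1 as λ → 0. -/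

import Mathlib

open Filter

noncomputable section

/-- `±1`-value of a Boolean (`true ↔ 1`, `false ↔ -1`). -/
def bval (b : Bool) : ℝ := if b then 1 else -1

/-- The Anderson–Bernoulli Hamiltonian `H_N(ε)` on `[1,N]` with Dirichlet
boundary conditions: tridiagonal with diagonal `λ ε_1, …, λ ε_N` and
off-diagonal entries `1`. -/
def HN (lam : ℝ) (N : ℕ) (σ : Fin N → Bool) : Matrix (Fin N) (Fin N) ℝ :=
  Matrix.of fun i j =>
    if i = j then lam * bval (σ i)
    else if (i : ℕ) + 1 = (j : ℕ) ∨ (j : ℕ) + 1 = (i : ℕ) then 1 else 0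

/-- The number of eigenvalues of `H_N(ε)` that are `≤ E`, counted with
multiplicity. -/
def eigCount (lam : ℝ) (N : ℕ) (σ : Fin N → Bool) (E : ℝ) : ℕ := by
  classical
  exact if h : (HN lam N σ).IsHermitian then
    (Finset.univ.filter fun j => h.eigenvalues j ≤ E).card
  else 0

lemma one_add_rpow_neg_le {s x : ℝ} (hs : 0 < s) (hs1 : s < 1) (hx : |x| ≤ 1 / 2) :
    (1 + x) ^ (-s) ≤ 1 - s * x + s * (s + 1) / 2 * x ^ 2 + 8 * |x| ^ 3 := by
  have hx2 := abs_le.1 hx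
  have hpos : 0 < 1 + x := by linarith
  have hlog := Real.abs_log_sub_add_sum_range_le (x := -x) (by rw [abs_neg]; linarith) 2
  rw [abs_neg, sub_neg_eq_add] at hlog
  norm_num [Finset.sum_range_succ] at hlog
  set t := |x| with ht
  have ht0 : 0 ≤ t := abs_nonneg x
  have ht2 : x ^ 2 = t ^ 2 := (sq_abs x).symm
  have hb : t ^ 3 / (1 - t) ≤ 2 * t ^ 3 := by
    rw [div_le_iff₀ (by linarith)]
    nlinarith [pow_nonneg ht0 3]
  obtain ⟨h1, h2⟩ := abs_le.1 (hlog.trans hb)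
  set r := Real.log (1 + x) - x + x ^ 2 / 2 with hr
  have hr1 : |r| ≤ 2 * t ^ 3 := abs_le.2 ⟨by linarith, by linarith⟩
  set y := -s * Real.log (1 + x) with hy
  have hyr : y = -s * x + s * x ^ 2 / 2 - s * r := by rw [hy, hr]; ring
  have ht3 : t ^ 3 ≤ t / 4 := by nlinarith [mul_nonneg ht0 ht0, mul_nonneg ht0 (sub_nonneg.2 hx)]
  have ht22 : t ^ 2 ≤ t / 2 := by nlinarith
  have hsr : |s * r| ≤ 2 * t ^ 3 := by
    rw [abs_mul, abs_of_pos hs]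
    nlinarith [abs_nonneg r]
  have hsx : |-s * x| ≤ t := by
    rw [abs_mul, abs_neg, abs_of_pos hs]
    nlinarith
  have hsx2 : |s * x ^ 2 / 2| ≤ t ^ 2 / 2 := by
    rw [ht2, abs_of_nonneg (by positivity)]
    nlinarith [sq_nonneg t]
  have hgab : |s * x ^ 2 / 2 - s * r| ≤ 3 / 2 * t ^ 2 := by
    have := abs_sub (s * x ^ 2 / 2) (s * r)
    nlinarith [mul_nonneg ht0 (sub_nonneg.2 hx), mul_nonneg (sq_nonneg t) (sub_nonneg.2 hx)]
  have hyabs : |y| ≤ 7 / 4 * t := by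
    have : y = -s * x + (s * x ^ 2 / 2 - s * r) := by rw [hyr]; ring
    rw [this]
    refine (abs_add_le _ _).trans ?_
    linarith
  have hexp := Real.exp_bound (x := y) (by linarith) (n := 3) (by norm_num)
  norm_num [Finset.sum_range_succ, Nat.factorial] at hexp
  have hy3 : |y| ^ 3 ≤ (7 / 4 * t) ^ 3 := pow_le_pow_left₀ (abs_nonneg _) hyabs 3
  have hexp' := (abs_le.1 hexp).2
  have hysq : y ^ 2 ≤ s ^ 2 * x ^ 2 + 3 * t ^ 3 + 9 / 4 * t ^ 4 := by
    set g := s * x ^ 2 / 2 - s * r with hg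
    have e1 : y = -s * x + g := by rw [hyr]; ring
    have e2 : y ^ 2 = s ^ 2 * x ^ 2 + 2 * ((-s * x) * g) + g ^ 2 := by rw [e1]; ring
    have e3 : (-s * x) * g ≤ t * (3 / 2 * t ^ 2) := by
      refine (le_abs_self _).trans ?_
      rw [abs_mul]
      exact mul_le_mul hsx hgab (abs_nonneg _) ht0
    have e4 : g ^ 2 ≤ (3 / 2 * t ^ 2) ^ 2 := by
      rw [← sq_abs]
      exact pow_le_pow_left₀ (abs_nonneg _) hgab 2
    rw [e2]
    linarith
  have ht4 : t ^ 4 ≤ t ^ 3 / 2 := by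
    have := mul_le_mul_of_nonneg_left hx (pow_nonneg ht0 3)
    linarith
  have hfin : (1 + x) ^ (-s) = Real.exp y := by
    rw [Real.rpow_def_of_pos hpos, hy]; ring_nf
  rw [hfin]
  have hsr2 := neg_abs_le (s * r)
  have ht33 := pow_nonneg ht0 3
  linarith

set_option maxHeartbeats 1600000 in
/-- One-step second-order expansion with its corrector. -/
lemma expand_step {s C l : ℝ} (hs : 0 < s) (hs1 : s < 1) (hC : 1 ≤ C) (hl : 0 < l)
    (hl1 : l * C ≤ 1 / 6) {p a ψ₀ e χ : ℝ} (hp : |p| ≤ C) (ha : |a| ≤ C) (hψ₀ : |ψ₀| ≤ C)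
    (he : |e| ≤ C * l ^ 3) (hχ : |χ - ψ₀| ≤ C * l) :
    (1 - l * p + l ^ 2 * a + e) ^ (-s) * (1 + l ^ 2 * χ) ≤
      1 + s * l * p + l ^ 2 * (s * (s + 1) / 2 * p ^ 2 - s * a + ψ₀) + 700 * C ^ 3 * l ^ 3 := by
  have hl6 : l ≤ 1 / 6 := by nlinarith
  set g := l ^ 2 * a + e with hg
  set x := -(l * p) + g with hx
  have hgb : |g| ≤ 2 * C * l ^ 2 := by
    refine (abs_add_le _ _).trans ?_
    rw [abs_mul, abs_of_pos (by positivity : (0:ℝ) < l ^ 2)]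
    have : l ^ 2 * |a| ≤ l ^ 2 * C := by gcongr
    have : C * l ^ 3 ≤ C * l ^ 2 := by
      gcongr ?_ * ?_
      nlinarith [sq_nonneg l]
    linarith
  have hlp : |-(l * p)| ≤ C * l := by
    rw [abs_neg, abs_mul, abs_of_pos hl]; nlinarith
  have hCl : 0 < C * l := by positivity
  have hxb : |x| ≤ 3 * (C * l) := by
    refine (abs_add_le _ _).trans ?_
    nlinarith
  have h1 := one_add_rpow_neg_le hs hs1 (x := x) (by linarith)
  have hxsq : x ^ 2 ≤ l ^ 2 * p ^ 2 + 8 * C ^ 2 * l ^ 3 := by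
    have e2 : x ^ 2 = l ^ 2 * p ^ 2 + 2 * (-(l * p) * g) + g ^ 2 := by rw [hx]; ring
    have e3 : -(l * p) * g ≤ (C * l) * (2 * C * l ^ 2) := by
      refine (le_abs_self _).trans ?_
      rw [abs_mul]
      exact mul_le_mul hlp hgb (abs_nonneg _) hCl.le
    have e4 : g ^ 2 ≤ (2 * C * l ^ 2) ^ 2 := by
      rw [← sq_abs]
      exact pow_le_pow_left₀ (abs_nonneg _) hgb 2
    have e5 : (2 * C * l ^ 2) ^ 2 ≤ 4 * C ^ 2 * l ^ 3 := by
      have : (2 * C * l ^ 2) ^ 2 = 4 * C ^ 2 * l ^ 3 * l := by ring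
      rw [this]
      exact mul_le_of_le_one_right (by positivity) (by linarith)
    linarith
  have hx3 : |x| ^ 3 ≤ 27 * C ^ 3 * l ^ 3 := by
    calc |x| ^ 3 ≤ (3 * (C * l)) ^ 3 := pow_le_pow_left₀ (abs_nonneg _) hxb 3
      _ = _ := by ring
  have hss : s * (s + 1) / 2 ≤ 1 := by nlinarith
  have hss0 : 0 ≤ s * (s + 1) / 2 := by positivity
  have hC3 : C ^ 2 ≤ C ^ 3 := by nlinarith [sq_nonneg C]
  have hC2 : C ≤ C ^ 2 := by nlinarith
  have hl3 : 0 < l ^ 3 := by positivity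
  have hse : -(s * e) ≤ C * l ^ 3 := by
    refine (neg_le_abs _).trans ?_
    rw [abs_mul, abs_of_pos hs]
    exact (mul_le_of_le_one_left (abs_nonneg _) hs1.le).trans he
  set f := s * (s + 1) / 2 * p ^ 2 - s * a with hf
  have hup : (1 + x) ^ (-s) ≤ 1 + s * l * p + l ^ 2 * f + 225 * C ^ 3 * l ^ 3 := by
    have e1 : s * (s + 1) / 2 * x ^ 2 ≤
        s * (s + 1) / 2 * (l ^ 2 * p ^ 2) + 8 * C ^ 2 * l ^ 3 := by
      have := mul_le_mul_of_nonneg_left hxsq hss0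
      have h8 : s * (s + 1) / 2 * (8 * C ^ 2 * l ^ 3) ≤ 8 * C ^ 2 * l ^ 3 :=
        mul_le_of_le_one_left (by positivity) hss
      linarith
    have e2 : -(s * x) = s * l * p - s * l ^ 2 * a - s * e := by rw [hx, hg]; ring
    have e3 : C ^ 2 * l ^ 3 ≤ C ^ 3 * l ^ 3 := by gcongr
    have e4 : C * l ^ 3 ≤ C ^ 3 * l ^ 3 := by gcongr; linarith
    rw [hf]
    linarith
  have hχb : |χ| ≤ 2 * C := by
    have := abs_add_le (χ - ψ₀) ψ₀
    rw [sub_add_cancel] at this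
    linarith
  have hχ1 : |l ^ 2 * χ| ≤ 2 * (C * l ^ 2) := by
    rw [abs_mul, abs_of_pos (by positivity : (0:ℝ) < l ^ 2)]
    linarith [mul_le_mul_of_nonneg_left hχb (sq_nonneg l)]
  have hχpos : 0 < 1 + l ^ 2 * χ := by
    have := (abs_le.1 hχ1).1
    nlinarith
  have hpf : |f| ≤ 2 * C ^ 2 := by
    have e1 : s * (s + 1) / 2 * p ^ 2 ≤ C ^ 2 := by
      have : p ^ 2 ≤ C ^ 2 := by rw [← sq_abs]; exact pow_le_pow_left₀ (abs_nonneg _) hp 2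
      exact (mul_le_of_le_one_left (sq_nonneg p) hss).trans this
    have e2 : |s * a| ≤ C := by
      rw [abs_mul, abs_of_pos hs]; exact (mul_le_of_le_one_left (abs_nonneg _) hs1.le).trans ha
    obtain ⟨e3, e4⟩ := abs_le.1 e2
    rw [abs_le, hf]
    constructor
    · linarith [mul_nonneg hss0 (sq_nonneg p)]
    · linarith
  have hrest : |s * l * p + l ^ 2 * f + 225 * C ^ 3 * l ^ 3| ≤ 228 * (C * l) := by
    have e1 : |s * l * p| ≤ C * l := by
      have : |s * l * p| = s * |-(l * p)| := by
        rw [abs_neg, mul_assoc, abs_mul, abs_of_pos hs]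
      rw [this]; exact (mul_le_of_le_one_left (abs_nonneg _) hs1.le).trans hlp
    have e2 : |l ^ 2 * f| ≤ 2 * (C * l) := by
      rw [abs_mul, abs_of_pos (by positivity : (0:ℝ) < l ^ 2)]
      have := mul_le_mul_of_nonneg_left hpf (sq_nonneg l)
      nlinarith
    have e3 : |225 * C ^ 3 * l ^ 3| ≤ 225 * (C * l) := by
      rw [abs_of_pos (by positivity)]
      have : 225 * C ^ 3 * l ^ 3 = 225 * (C * l) * (C * l) ^ 2 := by ring
      rw [this]
      exact mul_le_of_le_one_right (by positivity) (by nlinarith)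
    have := abs_add_three (s * l * p) (l ^ 2 * f) (225 * C ^ 3 * l ^ 3)
    linarith
  have hx1 : 1 - l * p + l ^ 2 * a + e = 1 + x := by rw [hx, hg]; ring
  rw [hx1]
  have hcross : l ^ 2 * χ * (s * l * p + l ^ 2 * f + 225 * C ^ 3 * l ^ 3) ≤
      456 * C ^ 2 * l ^ 3 := by
    refine (le_abs_self _).trans ?_
    rw [abs_mul]
    calc _ ≤ 2 * (C * l ^ 2) * (228 * (C * l)) :=
          mul_le_mul hχ1 hrest (abs_nonneg _) (by positivity)
      _ = _ := by ring
  have hχ2 : l ^ 2 * χ ≤ l ^ 2 * ψ₀ + C * l ^ 3 := by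
    have := mul_le_mul_of_nonneg_left ((le_abs_self _).trans hχ) (sq_nonneg l)
    linarith
  have e3 : C ^ 2 * l ^ 3 ≤ C ^ 3 * l ^ 3 := by gcongr
  have e4 : C * l ^ 3 ≤ C ^ 3 * l ^ 3 := by gcongr; linarith
  have e5 : 0 ≤ C ^ 3 * l ^ 3 := by positivity
  calc (1 + x) ^ (-s) * (1 + l ^ 2 * χ)
      ≤ (1 + s * l * p + l ^ 2 * f + 225 * C ^ 3 * l ^ 3) * (1 + l ^ 2 * χ) := by gcongr
    _ = 1 + s * l * p + l ^ 2 * f + 225 * C ^ 3 * l ^ 3 + l ^ 2 * χ +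
        l ^ 2 * χ * (s * l * p + l ^ 2 * f + 225 * C ^ 3 * l ^ 3) := by ring
    _ ≤ _ := by linarith

/-- Second-order averaging. -/
lemma average_step {s C κ l : ℝ} (hs : 0 < s) (hs1 : s < 1) (hC : 1 ≤ C) (hκ : 0 < κ)
    (hl : 0 < l) (hl1 : l * C ≤ 1 / 6) (hl2 : l * C ^ 3 ≤ κ / 2800)
    {p a ψ ψ₀ e₁ e₂ ψ₁ ψ₂ : ℝ} (hp : |p| ≤ C) (ha : |a| ≤ C) (hψ : |ψ| ≤ C) (hψ₀ : |ψ₀| ≤ C)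
    (he₁ : |e₁| ≤ C * l ^ 3) (he₂ : |e₂| ≤ C * l ^ 3)
    (hψ₁ : |ψ₁ - ψ₀| ≤ C * l) (hψ₂ : |ψ₂ - ψ₀| ≤ C * l)
    (hdrift : ψ₀ - ψ + s * (s + 1) / 2 * p ^ 2 - s * a ≤ -κ) :
    (1 - l * p + l ^ 2 * a + e₁) ^ (-s) * (1 + l ^ 2 * ψ₁) +
      (1 + l * p + l ^ 2 * a + e₂) ^ (-s) * (1 + l ^ 2 * ψ₂) ≤
      2 * (1 - κ / 2 * l ^ 2) * (1 + l ^ 2 * ψ) := by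
  have hl6 : l ≤ 1 / 6 := by nlinarith
  have k1 := expand_step hs hs1 hC hl hl1 hp ha hψ₀ he₁ hψ₁
  have k2 := expand_step hs hs1 hC hl hl1 (p := -p) (by rwa [abs_neg]) ha hψ₀ he₂ hψ₂
  rw [mul_neg, sub_neg_eq_add] at k2
  have hl2' : 0 < l ^ 2 := by positivity
  have hd := mul_le_mul_of_nonneg_left hdrift hl2'.le
  have h700 : 700 * C ^ 3 * l ^ 3 ≤ κ / 4 * l ^ 2 := by
    have : 700 * C ^ 3 * l ^ 3 = 700 * (l * C ^ 3) * l ^ 2 := by ring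
    rw [this]; gcongr; linarith
  have hψl : κ / 2 * l ^ 2 * (l ^ 2 * ψ) ≤ κ / 4 * l ^ 2 := by
    have e1 : l ^ 2 * ψ ≤ 1 / 2 := by
      have := mul_le_mul_of_nonneg_left ((le_abs_self _).trans hψ) hl2'.le
      nlinarith
    linarith [mul_le_mul_of_nonneg_left e1 (by positivity : 0 ≤ κ / 2 * l ^ 2)]
  linarith

/-- The corrector at energy `E`, in the normalised variables `p` (derivative of the quadratic
form along the potential) and `r` (centred mass at the current site). -/
def corr (s E p r : ℝ) : ℝ :=
  s * (s + 1) / 8 * (p ^ 2 - (4 - E ^ 2) * r ^ 2) - s * (s + 1) / 2 * ((E ^ 2 / 2 - 1) / E) * (p * r)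
    - s / 2 * r - s * (E / (2 * (4 - E ^ 2))) * p

lemma corr_drift {s E p r : ℝ} (hE : E ≠ 0) (hE4 : 4 - E ^ 2 ≠ 0) :
    corr s E ((E ^ 2 / 2 - 1) * p - E * (2 - E ^ 2 / 2) * r) ((E ^ 2 / 2 - 1) * r + E / 2 * p)
      - corr s E p r + s * (s + 1) / 2 * p ^ 2 - s * (r + 2 / (4 - E ^ 2)) =
    s * (s + 1) / 4 * (p ^ 2 + (4 - E ^ 2) * r ^ 2) - s * (2 / (4 - E ^ 2)) := by
  unfold corr
  field_simp
  ring

lemma corr_drift_le {s E A B D : ℝ} (hs : 0 < s) (hs1 : s < 1) (hE : E ≠ 0) (hE4 : 0 < 4 - E ^ 2)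
    (hQ : A + D - E * B = 1) (hB : B ^ 2 ≤ A * D) :
    corr s E (E * (E ^ 2 * A + D - 2 * E * B) - 2 * (E * A - B))
        (E ^ 2 * A + D - 2 * E * B - 2 / (4 - E ^ 2))
      - corr s E (E * A - 2 * B) (A - 2 / (4 - E ^ 2)) + s * (s + 1) / 2 * (E * A - 2 * B) ^ 2
      - s * A ≤ -(s * (1 - s) / 4) := by
  have hD : D = 1 - A + E * B := by linarith
  have h := corr_drift (s := s) (p := E * A - 2 * B) (r := A - 2 / (4 - E ^ 2)) hE hE4.ne'
  have e1 : (E ^ 2 / 2 - 1) * (E * A - 2 * B) - E * (2 - E ^ 2 / 2) * (A - 2 / (4 - E ^ 2)) =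
      E * (E ^ 2 * A + D - 2 * E * B) - 2 * (E * A - B) := by
    rw [hD]; field_simp; ring
  have e2 : (E ^ 2 / 2 - 1) * (A - 2 / (4 - E ^ 2)) + E / 2 * (E * A - 2 * B) =
      E ^ 2 * A + D - 2 * E * B - 2 / (4 - E ^ 2) := by
    rw [hD]; field_simp; ring
  rw [e1, e2, sub_add_cancel] at h
  rw [h]
  have e3 : (E * A - 2 * B) ^ 2 + (4 - E ^ 2) * (A - 2 / (4 - E ^ 2)) ^ 2 =
      4 / (4 - E ^ 2) - 4 * (A * D - B ^ 2) := by
    rw [hD]; field_simp; ring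
  have e4 : 1 / 4 ≤ 1 / (4 - E ^ 2) := one_div_le_one_div_of_le hE4 (by nlinarith)
  have e5 : 4 / (4 - E ^ 2) = 4 * (1 / (4 - E ^ 2)) := by ring
  have e6 : 2 / (4 - E ^ 2) = 2 * (1 / (4 - E ^ 2)) := by ring
  rw [e3, e5, e6]
  have e7 : 0 ≤ s * (s + 1) / 4 * (4 * (A * D - B ^ 2)) := by
    have : 0 ≤ A * D - B ^ 2 := by linarith
    positivity
  have e8 : s * (1 - s) * (1 / 4) ≤ s * (1 - s) * (1 / (4 - E ^ 2)) :=
    mul_le_mul_of_nonneg_left e4 (mul_nonneg hs.le (by linarith))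
  linarith

lemma abs_corr_coeff {s E k : ℝ} (hs : 0 < s) (hs1 : s < 1) (hE4 : 0 < 4 - E ^ 2)
    (hEk : 1 / |E| ≤ k / 2) (hEk' : 1 / (4 - E ^ 2) ≤ k / 6) :
    |s * (s + 1) / 2 * ((E ^ 2 / 2 - 1) / E)| ≤ k / 2 ∧ |s * (E / (2 * (4 - E ^ 2)))| ≤ k / 6 := by
  have hss : s * (s + 1) / 2 ≤ 1 := by nlinarith
  have hE2 : |E| ≤ 2 := abs_le_of_sq_le_sq (by linarith) (by norm_num)
  have hγ : |E ^ 2 / 2 - 1| ≤ 1 := by rw [abs_le]; constructor <;> nlinarith [sq_nonneg E]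
  constructor
  · rw [abs_mul, abs_of_pos (by positivity), abs_div, div_eq_mul_one_div |E ^ 2 / 2 - 1|]
    have : |E ^ 2 / 2 - 1| * (1 / |E|) ≤ 1 * (k / 2) :=
      mul_le_mul hγ hEk (by positivity) zero_le_one
    calc _ ≤ 1 * (1 * (k / 2)) := mul_le_mul hss this (by positivity) zero_le_one
      _ = _ := by ring
  · rw [abs_mul, abs_of_pos hs, abs_div, abs_of_pos (by linarith : 0 < 2 * (4 - E ^ 2))]
    have : |E| / (2 * (4 - E ^ 2)) = (|E| / 2) * (1 / (4 - E ^ 2)) := by field_simp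
    rw [this]
    have : (|E| / 2) * (1 / (4 - E ^ 2)) ≤ 1 * (k / 6) :=
      mul_le_mul (by linarith) hEk' (by positivity) zero_le_one
    calc _ ≤ 1 * (1 * (k / 6)) := mul_le_mul hs1.le this (by positivity) zero_le_one
      _ = _ := by ring

lemma corr_lipschitz {s E k M d p r p' r' : ℝ} (hs : 0 < s) (hs1 : s < 1) (hE4 : 0 < 4 - E ^ 2)
    (hk : 2 ≤ k) (hEk : 1 / |E| ≤ k / 2) (hEk' : 1 / (4 - E ^ 2) ≤ k / 6) (hM : 1 ≤ M)
    (hp : |p| ≤ M) (hr : |r| ≤ M) (hp' : |p'| ≤ M) (hr' : |r'| ≤ M)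
    (hdp : |p' - p| ≤ d) (hdr : |r' - r| ≤ d) :
    |corr s E p' r' - corr s E p r| ≤ 4 * k * M * d := by
  obtain ⟨hc2, hc4⟩ := abs_corr_coeff hs hs1 hE4 hEk hEk'
  set c2 := s * (s + 1) / 2 * ((E ^ 2 / 2 - 1) / E)
  set c4 := s * (E / (2 * (4 - E ^ 2)))
  have hd : 0 ≤ d := (abs_nonneg _).trans hdp
  have hM0 : 0 ≤ M := by linarith
  have h : corr s E p' r' - corr s E p r =
      s * (s + 1) / 8 * ((p' - p) * (p' + p)) -
      s * (s + 1) / 8 * (4 - E ^ 2) * ((r' - r) * (r' + r)) -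
      c2 * ((p' - p) * r' + p * (r' - r)) - s / 2 * (r' - r) - c4 * (p' - p) := by
    unfold corr; ring
  have hpp : |(p' - p) * (p' + p)| ≤ d * (2 * M) := by
    rw [abs_mul]
    exact mul_le_mul hdp ((abs_add_le _ _).trans (by linarith)) (abs_nonneg _) hd
  have hrr : |(r' - r) * (r' + r)| ≤ d * (2 * M) := by
    rw [abs_mul]
    exact mul_le_mul hdr ((abs_add_le _ _).trans (by linarith)) (abs_nonneg _) hd
  have hpr : |(p' - p) * r' + p * (r' - r)| ≤ 2 * (d * M) := by
    refine (abs_add_le _ _).trans ?_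
    rw [abs_mul, abs_mul]
    have := mul_le_mul hdp hr' (abs_nonneg _) hd
    have := mul_le_mul hp hdr (abs_nonneg _) hM0
    linarith
  have hs8 : s * (s + 1) / 8 ≤ 1 / 4 := by nlinarith
  have hs80 : 0 ≤ s * (s + 1) / 8 := by positivity
  have t1 : |s * (s + 1) / 8 * ((p' - p) * (p' + p))| ≤ 1 / 4 * (d * (2 * M)) := by
    rw [abs_mul, abs_of_nonneg hs80]
    exact mul_le_mul hs8 hpp (abs_nonneg _) (by norm_num)
  have t2 : |s * (s + 1) / 8 * (4 - E ^ 2) * ((r' - r) * (r' + r))| ≤ 1 * (d * (2 * M)) := by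
    rw [abs_mul, abs_of_nonneg (mul_nonneg hs80 hE4.le)]
    refine mul_le_mul ?_ hrr (abs_nonneg _) (by norm_num)
    have := mul_le_mul hs8 (by nlinarith [sq_nonneg E] : 4 - E ^ 2 ≤ 4) hE4.le (by norm_num)
    linarith
  have t3 : |c2 * ((p' - p) * r' + p * (r' - r))| ≤ k / 2 * (2 * (d * M)) := by
    rw [abs_mul]
    exact mul_le_mul hc2 hpr (abs_nonneg _) (by linarith)
  have t4 : |s / 2 * (r' - r)| ≤ 1 / 2 * d := by
    rw [abs_mul, abs_of_pos (by positivity)]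
    exact mul_le_mul (by linarith) hdr (abs_nonneg _) (by norm_num)
  have t5 : |c4 * (p' - p)| ≤ k / 6 * d := by
    rw [abs_mul]
    exact mul_le_mul hc4 hdp (abs_nonneg _) (by linarith)
  have hfin : 1 / 4 * (d * (2 * M)) + 1 * (d * (2 * M)) + k / 2 * (2 * (d * M)) + 1 / 2 * d
      + k / 6 * d ≤ 4 * k * M * d := by
    have hkM : 2 * M ≤ k * M := by gcongr
    have hkk : k ≤ k * M := le_mul_of_one_le_right (by linarith) hM
    have : 1 / 4 * (2 * M) + 1 * (2 * M) + k / 2 * (2 * M) + 1 / 2 + k / 6 ≤ 4 * k * M := by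
      linarith
    have := mul_le_mul_of_nonneg_right this hd
    linarith
  rw [h]
  rw [abs_le] at *
  constructor <;> linarith [t1.1, t1.2, t2.1, t2.2, t3.1, t3.2, t4.1, t4.2, t5.1, t5.2]

lemma abs_div_sub_le {X A A' : ℝ} (hX : 1 / 2 ≤ X) :
    |A' / X - A| ≤ 2 * (|A' - A| + |A| * |X - 1|) := by
  have hX0 : 0 < X := by linarith
  have : A' / X - A = (A' - A - A * (X - 1)) / X := by field_simp; ring
  rw [this, abs_div, abs_of_pos hX0, div_le_iff₀ hX0]
  have h1 : |A' - A - A * (X - 1)| ≤ |A' - A| + |A| * |X - 1| := by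
    rw [← abs_mul]; exact abs_sub _ _
  have h2 : 0 ≤ |A' - A| + |A| * |X - 1| := by positivity
  nlinarith

/-- Perturbation bounds for one normalised step. -/
lemma perturb_bounds {s E k l μ η A B D J : ℝ} (hs : 0 < s) (hs1 : s < 1) (hE4 : 0 < 4 - E ^ 2)
    (hk : 2 ≤ k) (hEk : 1 / |E| ≤ k / 2) (hEk' : 1 / (4 - E ^ 2) ≤ k / 6)
    (hl : 0 < l) (hlk : k ^ 2 * l ≤ 1 / 1000) (hμ : |μ| = l) (hη : 0 ≤ η) (hηl : η ≤ l ^ 3)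
    (hA : |A| ≤ k) (hD : |D| ≤ k) (hB : |B| ≤ k / 2) (hJ : |J| ≤ k / 2) :
    let a := (E - μ) ^ 2 * A + η ^ 2 * A + D - 2 * (E - μ) * B + 2 * η * J
    let X := 1 - μ * (E * A - 2 * B) + l ^ 2 * A + (η ^ 2 * A + 2 * η * J)
    |corr s E (E * (a / X) - 2 * (((E - μ) * A - B) / X)) (a / X - 2 / (4 - E ^ 2)) -
      corr s E (E * (E ^ 2 * A + D - 2 * E * B) - 2 * (E * A - B))
        (E ^ 2 * A + D - 2 * E * B - 2 / (4 - E ^ 2))| ≤ 21000 * k ^ 4 * l ∧ 1 / 2 ≤ X := by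
  intro a X
  have hk0 : 0 < k := by linarith
  have hkl : k * l ≤ 1 / 1000 := by nlinarith [mul_pos hk0 hl]
  have hl1 : l ≤ 1 / 2000 := by nlinarith
  have hl3 : l ^ 3 ≤ l := by
    have : l ^ 3 = l * l ^ 2 := by ring
    rw [this]; exact mul_le_of_le_one_right hl.le (by nlinarith)
  have hηl' : η ≤ l := hηl.trans hl3
  have hE2 : |E| ≤ 2 := abs_le_of_sq_le_sq (by linarith) (by norm_num)
  have hμl : |μ| ≤ l := hμ.le
  have sm : ∀ {x y u v : ℝ}, |x| ≤ u → |y| ≤ v → |x * y| ≤ u * v := fun {x y u v} h1 h2 => by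
    rw [abs_mul]; exact mul_le_mul h1 h2 (abs_nonneg _) ((abs_nonneg _).trans h1)
  have hl2' : |l| ≤ l := (abs_of_pos hl).le
  have hηη : |η| ≤ l := by rwa [abs_of_nonneg hη]
  have hη2 : η ^ 2 ≤ l := by nlinarith
  have hμ2 : μ ^ 2 ≤ l := by rw [← sq_abs, hμ]; nlinarith
  have hl2 : l ^ 2 ≤ l := by nlinarith
  have habs1 : |η ^ 2 * A| ≤ l * k := sm (by rwa [abs_of_nonneg (sq_nonneg _)]) hA
  have habs2 : |η * J| ≤ l * (k / 2) := sm hηη hJ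
  have habs3 : |μ * (E * A)| ≤ l * (2 * k) := sm hμl (sm hE2 hA)
  have habs4 : |μ * B| ≤ l * (k / 2) := sm hμl hB
  have habs5 : |μ ^ 2 * A| ≤ l * k := sm (by rwa [abs_of_nonneg (sq_nonneg _)]) hA
  have habs6 : |l ^ 2 * A| ≤ l * k := sm (by rwa [abs_of_nonneg (sq_nonneg _)]) hA
  have habs7 : |μ * A| ≤ l * k := sm hμl hA
  have habs8 : |E * (E * A)| ≤ 2 * (2 * k) := sm hE2 (sm hE2 hA)
  have habs9 : |E * B| ≤ 2 * (k / 2) := sm hE2 hB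
  have habs10 : |E * A| ≤ 2 * k := sm hE2 hA
  have hX1 : |X - 1| ≤ 6 * (k * l) := by
    have : X - 1 = -(μ * (E * A)) + 2 * (μ * B) + l ^ 2 * A + η ^ 2 * A + 2 * (η * J) := by
      simp only [X]; ring
    rw [this]
    rw [abs_le] at *
    constructor <;> linarith [habs3.1, habs3.2, habs4.1, habs4.2, habs6.1, habs6.2, habs1.1,
      habs1.2, habs2.1, habs2.2]
  have hXh : 1 / 2 ≤ X := by have := (abs_le.1 hX1).1; linarith
  set a0 := E ^ 2 * A + D - 2 * E * B with ha0
  have ha0b : |a0| ≤ 7 * k := by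
    have : a0 = E * (E * A) + D - 2 * (E * B) := by rw [ha0]; ring
    rw [this]
    rw [abs_le] at *
    constructor <;> linarith [habs8.1, habs8.2, habs9.1, habs9.2, hD.1, hD.2]
  have hda : |a - a0| ≤ 8 * (k * l) := by
    have : a - a0 = -2 * (μ * (E * A)) + μ ^ 2 * A + η ^ 2 * A + 2 * (μ * B) + 2 * (η * J) := by
      simp only [a, ha0]; ring
    rw [this]
    rw [abs_le] at *
    constructor <;> linarith [habs3.1, habs3.2, habs4.1, habs4.2, habs5.1, habs5.2, habs1.1,
      habs1.2, habs2.1, habs2.2]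
  set b0 := E * A - B with hb0
  have hb0b : |b0| ≤ 5 / 2 * k := by
    rw [hb0]
    have := abs_sub (E * A) B
    linarith
  have hdb : |((E - μ) * A - B) - b0| ≤ k * l := by
    have : ((E - μ) * A - B) - b0 = -(μ * A) := by rw [hb0]; ring
    rw [this, abs_neg]; linarith
  have hkk : k * l ≤ k * (k * l) := le_mul_of_one_le_left (by positivity) (by linarith)
  have hda' : |a / X - a0| ≤ 100 * (k * (k * l)) := by
    refine (abs_div_sub_le hXh).trans ?_
    have := mul_le_mul ha0b hX1 (abs_nonneg _) (by positivity)
    linarith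
  have hdb' : |((E - μ) * A - B) / X - b0| ≤ 32 * (k * (k * l)) := by
    refine (abs_div_sub_le hXh).trans ?_
    have := mul_le_mul hb0b hX1 (abs_nonneg _) (by positivity)
    linarith
  set a1 := a / X
  set b1 := ((E - μ) * A - B) / X
  have hEda : |E * (a1 - a0)| ≤ 2 * (100 * (k * (k * l))) := sm hE2 hda'
  have hEa0 : |E * a0| ≤ 2 * (7 * k) := sm hE2 ha0b
  have hkkl : k * (k * l) ≤ 1 / 1000 := by linarith
  have h2E : 0 < 2 / (4 - E ^ 2) := by positivity
  have h2E' : 2 / (4 - E ^ 2) ≤ k / 3 := by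
    have : 2 / (4 - E ^ 2) = 2 * (1 / (4 - E ^ 2)) := by ring
    linarith
  have hpd : |(E * a1 - 2 * b1) - (E * a0 - 2 * b0)| ≤ 264 * (k * (k * l)) := by
    have : (E * a1 - 2 * b1) - (E * a0 - 2 * b0) = E * (a1 - a0) - 2 * (b1 - b0) := by ring
    rw [this]
    rw [abs_le] at *
    constructor <;> linarith [hEda.1, hEda.2, hdb'.1, hdb'.2]
  have hrd : |(a1 - 2 / (4 - E ^ 2)) - (a0 - 2 / (4 - E ^ 2))| ≤ 264 * (k * (k * l)) := by
    rw [sub_sub_sub_cancel_right]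
    refine hda'.trans ?_
    have : 0 ≤ k * (k * l) := by positivity
    linarith
  have hp0 : |E * a0 - 2 * b0| ≤ 19 * k := by
    rw [abs_le] at *
    constructor <;> linarith [hEa0.1, hEa0.2, hb0b.1, hb0b.2]
  have hr0 : |a0 - 2 / (4 - E ^ 2)| ≤ 8 * k := by
    rw [abs_le] at *
    constructor <;> linarith [ha0b.1, ha0b.2]
  have hp1 : |E * a1 - 2 * b1| ≤ 39 / 2 * k := by
    have := abs_sub_abs_le_abs_sub (E * a1 - 2 * b1) (E * a0 - 2 * b0)
    linarith
  have hr1 : |a1 - 2 / (4 - E ^ 2)| ≤ 39 / 2 * k := by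
    have := abs_sub_abs_le_abs_sub (a1 - 2 / (4 - E ^ 2)) (a0 - 2 / (4 - E ^ 2))
    linarith
  refine ⟨?_, hXh⟩
  have := corr_lipschitz (M := 39 / 2 * k) hs hs1 hE4 hk hEk hEk' (by linarith) (by linarith)
    (by linarith) hp1 hr1 hpd hrd
  refine this.trans ?_
  have : 4 * k * (39 / 2 * k) * (264 * (k * (k * l))) = 20592 * k ^ 4 * l := by ring
  rw [this]
  gcongr
  norm_num

set_option maxHeartbeats 800000 in
/-- The averaged contraction in normalised variables. -/
lemma normalized_step {s E k l η A B D J : ℝ} (hs : 0 < s) (hs1 : s < 1) (hE : E ≠ 0)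
    (hE4 : 0 < 4 - E ^ 2)
    (hk : 2 ≤ k) (hEk : 1 / |E| ≤ k / 2) (hEk' : 1 / (4 - E ^ 2) ≤ k / 6)
    (hl : 0 < l) (hl1 : l * (21000 * k ^ 4) ≤ 1 / 6)
    (hl2 : l * (21000 * k ^ 4) ^ 3 ≤ s * (1 - s) / 4 / 2800)
    (hη : 0 ≤ η) (hηl : η ≤ l ^ 3)
    (hA0 : 0 ≤ A) (hD0 : 0 ≤ D) (hAD : A + D ≤ k) (hB : B ^ 2 ≤ A * D) (hJ : J ^ 2 ≤ A * D)
    (hQ : A + D - E * B = 1) :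
    let a := fun μ => (E - μ) ^ 2 * A + η ^ 2 * A + D - 2 * (E - μ) * B + 2 * η * J
    let X := fun μ => 1 - μ * (E * A - 2 * B) + l ^ 2 * A + (η ^ 2 * A + 2 * η * J)
    let φ := fun p r => 1 + l ^ 2 * corr s E p (r - 2 / (4 - E ^ 2))
    (X l) ^ (-s) * φ (E * (a l / X l) - 2 * (((E - l) * A - B) / X l)) (a l / X l) +
    (X (-l)) ^ (-s) * φ (E * (a (-l) / X (-l)) - 2 * (((E - -l) * A - B) / X (-l)))
        (a (-l) / X (-l)) ≤
      2 * (1 - s * (1 - s) / 8 * l ^ 2) * φ (E * A - 2 * B) A ∧ 1 / 2 ≤ X l ∧ 1 / 2 ≤ X (-l) ∧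
      l ^ 2 * |corr s E (E * A - 2 * B) (A - 2 / (4 - E ^ 2))| ≤ 1 / 2 := by
  intro a X φ
  have hk0 : 0 < k := by linarith
  have hk4 : 1 ≤ k ^ 4 := one_le_pow₀ (by linarith)
  have hsq : A * D ≤ (k / 2) ^ 2 := by nlinarith [sq_nonneg (A - D)]
  have hBk : |B| ≤ k / 2 := abs_le_of_sq_le_sq (hB.trans hsq) (by linarith)
  have hJk : |J| ≤ k / 2 := abs_le_of_sq_le_sq (hJ.trans hsq) (by linarith)
  have hAk : |A| ≤ k := by rw [abs_of_nonneg hA0]; linarith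
  have hDk : |D| ≤ k := by rw [abs_of_nonneg hD0]; linarith
  have hE2 : |E| ≤ 2 := abs_le_of_sq_le_sq (by linarith) (by norm_num)
  have hlk : k ^ 2 * l ≤ 1 / 1000 := by
    have : k ^ 2 ≤ k ^ 4 := pow_le_pow_right₀ (by linarith) (by norm_num)
    nlinarith
  have hl1' : l ≤ 1 := by nlinarith
  obtain ⟨h1, hX1⟩ := perturb_bounds hs hs1 hE4 hk hEk hEk' hl hlk (abs_of_pos hl) hη hηl hAk hDk
    hBk hJk
  obtain ⟨h2, hX2⟩ := perturb_bounds (μ := -l) hs hs1 hE4 hk hEk hEk' hl hlk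
    (by rw [abs_neg, abs_of_pos hl]) hη hηl hAk hDk hBk hJk
  have hEA : |E * A| ≤ 2 * k := by
    rw [abs_mul]; exact mul_le_mul hE2 hAk (abs_nonneg _) (by norm_num)
  have hEB : |E * B| ≤ 2 * (k / 2) := by
    rw [abs_mul]; exact mul_le_mul hE2 hBk (abs_nonneg _) (by norm_num)
  have hp : |E * A - 2 * B| ≤ 3 * k := by
    rw [abs_le] at *
    constructor <;> linarith [hEA.1, hEA.2, hBk.1, hBk.2]
  have h2E : 0 < 2 / (4 - E ^ 2) := by positivity
  have h2E' : 2 / (4 - E ^ 2) ≤ k / 3 := by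
    have : 2 / (4 - E ^ 2) = 2 * (1 / (4 - E ^ 2)) := by ring
    linarith
  have hr : |A - 2 / (4 - E ^ 2)| ≤ 3 * k := by
    rw [abs_le] at *; constructor <;> linarith [hAk.1, hAk.2]
  have hkk : k ≤ k ^ 4 := by simpa using pow_le_pow_right₀ (by linarith : 1 ≤ k) (by norm_num : 1 ≤ 4)
  have hk3 : k ^ 3 ≤ k ^ 4 := pow_le_pow_right₀ (by linarith) (by norm_num)
  have bound : ∀ p r : ℝ, |p| ≤ 19 * k → |r| ≤ 19 * k → |corr s E p r| ≤ 21000 * k ^ 4 := by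
    intro p r hp hr
    have := corr_lipschitz (M := 19 * k) (d := 19 * k) (p := 0) (r := 0) hs hs1 hE4 hk hEk hEk'
      (by linarith) (by rw [abs_zero]; linarith) (by rw [abs_zero]; linarith) hp hr
      (by rwa [sub_zero]) (by rwa [sub_zero])
    have h0 : corr s E 0 0 = 0 := by simp [corr]
    rw [h0, sub_zero] at this
    refine this.trans ?_
    have : 4 * k * (19 * k) * (19 * k) = 1444 * k ^ 3 := by ring
    linarith
  have hψ := bound _ _ (hp.trans (by linarith)) (hr.trans (by linarith))
  have hEEA : |E * (E * A)| ≤ 2 * (2 * k) := by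
    rw [abs_mul]; exact mul_le_mul hE2 hEA (abs_nonneg _) (by norm_num)
  have ha0 : |E ^ 2 * A + D - 2 * E * B| ≤ 7 * k := by
    have : E ^ 2 * A + D - 2 * E * B = E * (E * A) + D - 2 * (E * B) := by ring
    rw [this]
    rw [abs_le] at *
    constructor <;> linarith [hEEA.1, hEEA.2, hDk.1, hDk.2, hEB.1, hEB.2]
  have hEa0 : |E * (E ^ 2 * A + D - 2 * E * B)| ≤ 2 * (7 * k) := by
    rw [abs_mul]; exact mul_le_mul hE2 ha0 (abs_nonneg _) (by norm_num)
  have hψ₀ := bound (E * (E ^ 2 * A + D - 2 * E * B) - 2 * (E * A - B))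
    (E ^ 2 * A + D - 2 * E * B - 2 / (4 - E ^ 2))
    (by rw [abs_le] at *; constructor <;> linarith [hEa0.1, hEa0.2, hEA.1, hEA.2, hBk.1, hBk.2])
    (by rw [abs_le] at *; constructor <;> linarith [ha0.1, ha0.2])
  have he : |η ^ 2 * A + 2 * η * J| ≤ 21000 * k ^ 4 * l ^ 3 := by
    have hl31 : l ^ 3 ≤ 1 := pow_le_one₀ hl.le hl1'
    have hη2 : η ^ 2 ≤ l ^ 3 := by
      have := mul_le_mul hηl (hηl.trans hl31) hη (by positivity)
      linarith
    have t1 : |η ^ 2 * A| ≤ l ^ 3 * k := by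
      rw [abs_mul, abs_of_nonneg (sq_nonneg η)]
      exact mul_le_mul hη2 hAk (abs_nonneg _) (by positivity)
    have t2 : |2 * η * J| ≤ l ^ 3 * k := by
      rw [abs_mul, abs_of_nonneg (by positivity)]
      have := mul_le_mul hηl hJk (abs_nonneg _) (by positivity)
      linarith
    have t3 : l ^ 3 * k ≤ l ^ 3 * k ^ 4 := by gcongr
    have := abs_add_le (η ^ 2 * A) (2 * η * J)
    have : 0 ≤ l ^ 3 * k ^ 4 := by positivity
    linarith
  have hdr := corr_drift_le hs hs1 hE hE4 hQ hB
  have hC1 : 1 ≤ 21000 * k ^ 4 := by linarith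
  have main := average_step hs hs1 hC1 (by nlinarith : 0 < s * (1 - s) / 4) hl hl1 hl2
    (hp.trans (by linarith)) (hAk.trans (by linarith)) hψ hψ₀ he he h1 h2 hdr
  refine ⟨?_, hX1, hX2, ?_⟩
  · simp only [X, φ, a]
    convert main using 2
    · ring_nf
    · ring_nf
  · have : l ^ 2 * |corr s E (E * A - 2 * B) (A - 2 / (4 - E ^ 2))| ≤
        l ^ 2 * (21000 * k ^ 4) := by gcongr
    have := mul_le_mul hl1' hl1 (by positivity) zero_le_one
    linarith

/-- The quadratic form invariant under the free transfer matrix at energy `E`. -/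
def qform (E : ℝ) (v : ℂ × ℂ) : ℝ :=
  Complex.normSq v.1 + Complex.normSq v.2 - E * (v.1 * (starRingEnd ℂ) v.2).re

/-- The transfer matrix with entry `t`. -/
def xfer (t : ℂ) (v : ℂ × ℂ) : ℂ × ℂ := (t * v.1 - v.2, v.1)

/-- The Lyapunov weight: `1` plus a second-order corrector. -/
def weight (s E l : ℝ) (v : ℂ × ℂ) : ℝ :=
  1 + l ^ 2 * corr s E (E * (Complex.normSq v.1 / qform E v)
    - 2 * ((v.1 * (starRingEnd ℂ) v.2).re / qform E v))
    (Complex.normSq v.1 / qform E v - 2 / (4 - E ^ 2))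

lemma le_qform {δ E : ℝ} (hE : |E| < 2 - δ) (v : ℂ × ℂ) :
    δ / 2 * (Complex.normSq v.1 + Complex.normSq v.2) ≤ qform E v := by
  obtain ⟨⟨x1, x2⟩, ⟨y1, y2⟩⟩ := v
  simp only [qform, Complex.normSq_apply, Complex.mul_re, Complex.conj_re, Complex.conj_im]
  obtain ⟨h1, h2⟩ := abs_lt.1 hE
  nlinarith [sq_nonneg (x1 - y1), sq_nonneg (x2 - y2), sq_nonneg (x1 + y1), sq_nonneg (x2 + y2)]

lemma qform_le {E : ℝ} (hE : |E| ≤ 2) (v : ℂ × ℂ) :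
    qform E v ≤ 2 * (Complex.normSq v.1 + Complex.normSq v.2) := by
  obtain ⟨⟨x1, x2⟩, ⟨y1, y2⟩⟩ := v
  simp only [qform, Complex.normSq_apply, Complex.mul_re, Complex.conj_re, Complex.conj_im]
  obtain ⟨h1, h2⟩ := abs_le.1 hE
  nlinarith [sq_nonneg (x1 - y1), sq_nonneg (x2 - y2), sq_nonneg (x1 + y1), sq_nonneg (x2 + y2)]

lemma normSq_add_pos {v : ℂ × ℂ} (hv : v ≠ 0) : 0 < Complex.normSq v.1 + Complex.normSq v.2 := by
  rcases eq_or_ne v.1 0 with h | h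
  · have h2 : v.2 ≠ 0 := fun h2 => hv (Prod.ext h h2)
    exact add_pos_of_nonneg_of_pos (Complex.normSq_nonneg _) (Complex.normSq_pos.2 h2)
  · exact add_pos_of_pos_of_nonneg (Complex.normSq_pos.2 h) (Complex.normSq_nonneg _)

lemma qform_pos {δ E : ℝ} (hδ : 0 < δ) (hE : |E| < 2 - δ) {v : ℂ × ℂ} (hv : v ≠ 0) :
    0 < qform E v :=
  lt_of_lt_of_le (mul_pos (by linarith) (normSq_add_pos hv)) (le_qform hE v)

lemma xfer_ne_zero (t : ℂ) {v : ℂ × ℂ} (hv : v ≠ 0) : xfer t v ≠ 0 := by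
  intro h
  have h1 : v.1 = 0 := congrArg Prod.snd h
  have h2 : t * v.1 - v.2 = 0 := congrArg Prod.fst h
  rw [h1, mul_zero, zero_sub, neg_eq_zero] at h2
  exact hv (Prod.ext h1 h2)

/-- For weak coupling, the weighted `-s`-th power of the quadratic form contracts in mean under
one random transfer matrix. -/
lemma exists_contraction {δ s : ℝ} (hδ : 0 < δ) (hδ1 : δ < 1) (hs : 0 < s) (hs1 : s < 1) :
    ∃ l₀ : ℝ, 0 < l₀ ∧ ∀ l : ℝ, 0 < l → l < l₀ →
      ∀ E : ℝ, δ < |E| → |E| < 2 - δ → ∀ η : ℝ, 0 ≤ η → η ≤ l ^ 3 → ∀ v : ℂ × ℂ, v ≠ 0 →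
        (∑ b : Bool, qform E (xfer (E + η * Complex.I - l * bval b) v) ^ (-s) *
          weight s E l (xfer (E + η * Complex.I - l * bval b) v)) ≤
          2 * (1 - s * (1 - s) / 8 * l ^ 2) * (qform E v ^ (-s) * weight s E l v) ∧
        |weight s E l v - 1| ≤ 1 / 2 := by
  set k : ℝ := 2 / δ with hkdef
  have hk : 2 ≤ k := by rw [hkdef, le_div_iff₀ hδ]; linarith
  set C := 21000 * k ^ 4 with hC
  have hC0 : 0 < C := by positivity
  have hss : 0 < s * (1 - s) := mul_pos hs (by linarith)
  refine ⟨min (1 / (6 * C)) (s * (1 - s) / 4 / 2800 / C ^ 3), by positivity, ?_⟩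
  intro l hl hl0 E hE1 hE2 η hη hηl v hv
  have hl1 : l * C ≤ 1 / 6 := by
    have := (lt_min_iff.1 hl0).1.le
    rw [le_div_iff₀ (by positivity)] at this
    linarith
  have hl2 : l * C ^ 3 ≤ s * (1 - s) / 4 / 2800 := by
    have := (lt_min_iff.1 hl0).2.le
    rwa [le_div_iff₀ (by positivity)] at this
  have hE0 : E ≠ 0 := by rintro rfl; rw [abs_zero] at hE1; linarith
  have hE43 : 3 * δ ≤ 4 - E ^ 2 := by
    rw [← sq_abs]
    nlinarith [abs_nonneg E]
  have hE4 : 0 < 4 - E ^ 2 := by linarith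
  have hEk : 1 / |E| ≤ k / 2 := by
    have : k / 2 = 1 / δ := by rw [hkdef]; ring
    rw [this]
    exact one_div_le_one_div_of_le hδ hE1.le
  have hEk' : 1 / (4 - E ^ 2) ≤ k / 6 := by
    have : k / 6 = 1 / (3 * δ) := by rw [hkdef]; field_simp; norm_num
    rw [this]
    exact one_div_le_one_div_of_le (by linarith) hE43
  set Q := qform E v with hQdef
  have hQ : 0 < Q := qform_pos hδ hE2 hv
  set A := Complex.normSq v.1 / Q with hA
  set D := Complex.normSq v.2 / Q with hD
  set B := (v.1 * (starRingEnd ℂ) v.2).re / Q with hB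
  set J := (v.1.im * v.2.re - v.1.re * v.2.im) / Q with hJ
  have hAD : A + D ≤ k := by
    rw [hA, hD, ← add_div, div_le_iff₀ hQ, hkdef]
    have := le_qform hE2 v
    rw [← hQdef] at this
    have h2 := mul_le_mul_of_nonneg_left this (by positivity : 0 ≤ 2 / δ)
    have h3 : 2 / δ * (δ / 2 * (Complex.normSq v.1 + Complex.normSq v.2)) =
      Complex.normSq v.1 + Complex.normSq v.2 := by field_simp
    linarith
  have hB2 : B ^ 2 ≤ A * D := by
    rw [hA, hD, hB, div_pow, div_mul_div_comm, ← sq]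
    gcongr
    simp only [Complex.normSq_apply, Complex.mul_re, Complex.conj_re, Complex.conj_im]
    nlinarith [sq_nonneg (v.1.im * v.2.re - v.1.re * v.2.im)]
  have hJ2 : J ^ 2 ≤ A * D := by
    rw [hA, hD, hJ, div_pow, div_mul_div_comm, ← sq]
    gcongr
    simp only [Complex.normSq_apply]
    nlinarith [sq_nonneg (v.1.re * v.2.re + v.1.im * v.2.im)]
  have hQ1 : A + D - E * B = 1 := by
    rw [hA, hD, hB, mul_div_assoc', ← add_div, ← sub_div, div_eq_one_iff_eq hQ.ne']
    rfl
  obtain ⟨hmain, hX1, hX2, hw⟩ := normalized_step hs hs1 hE0 hE4 hk hEk hEk' hl hl1 hl2 hη hηl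
    (div_nonneg (Complex.normSq_nonneg _) hQ.le) (div_nonneg (Complex.normSq_nonneg _) hQ.le) hAD
    hB2 hJ2 hQ1
  have hAQ : Complex.normSq v.1 = A * Q := by rw [hA]; field_simp
  have hDQ : Complex.normSq v.2 = D * Q := by rw [hD]; field_simp
  have hBQ : (v.1 * (starRingEnd ℂ) v.2).re = B * Q := by rw [hB]; field_simp
  have hJQ : v.1.im * v.2.re - v.1.re * v.2.im = J * Q := by rw [hJ]; field_simp
  have step : ∀ μ : ℝ, μ ^ 2 = l ^ 2 →
      (let a := (E - μ) ^ 2 * A + η ^ 2 * A + D - 2 * (E - μ) * B + 2 * η * J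
      let X := 1 - μ * (E * A - 2 * B) + l ^ 2 * A + (η ^ 2 * A + 2 * η * J)
      1 / 2 ≤ X → qform E (xfer (E + η * Complex.I - μ) v) ^ (-s) *
        weight s E l (xfer (E + η * Complex.I - μ) v) = Q ^ (-s) * (X ^ (-s) *
          (1 + l ^ 2 * corr s E (E * (a / X) - 2 * (((E - μ) * A - B) / X))
            (a / X - 2 / (4 - E ^ 2))))) := by
    intro μ hμ a X hX
    have e1 : Complex.normSq (xfer (E + η * Complex.I - μ) v).1 = a * Q := by
      have : a * Q = (E - μ) ^ 2 * (A * Q) + η ^ 2 * (A * Q) + D * Q - 2 * (E - μ) * (B * Q)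
          + 2 * η * (J * Q) := by ring
      rw [this, ← hAQ, ← hDQ, ← hBQ, ← hJQ]
      simp [xfer, Complex.normSq_apply]
      ring
    have e2 : ((xfer (E + η * Complex.I - μ) v).1 *
        (starRingEnd ℂ) (xfer (E + η * Complex.I - μ) v).2).re = ((E - μ) * A - B) * Q := by
      have : ((E - μ) * A - B) * Q = (E - μ) * (A * Q) - B * Q := by ring
      rw [this, ← hAQ, ← hBQ]
      simp [xfer, Complex.normSq_apply]
      ring
    have e3 : qform E (xfer (E + η * Complex.I - μ) v) = X * Q := by
      have : X * Q = a * Q + A * Q - E * (((E - μ) * A - B) * Q) := by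
        have : X = a + A - E * ((E - μ) * A - B) := by
          have hD' : D = 1 - A + E * B := by linarith
          simp only [a, X, hD', ← hμ]; ring
        rw [this]; ring
      rw [this, qform, e1, e2, ← hAQ]
      rfl
    have hX0 : 0 < X := by linarith
    rw [weight, e1, e2, e3, Real.mul_rpow hX0.le hQ.le, mul_div_mul_right _ _ hQ.ne',
      mul_div_mul_right _ _ hQ.ne']
    ring
  constructor
  · have s1 := step l rfl hX1
    have s2 := step (-l) (by ring) hX2
    simp only [Fintype.sum_bool, bval, if_true, Bool.false_eq_true, if_false, Complex.ofReal_one,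
      mul_one]
    have : (l : ℂ) * ((-1 : ℝ) : ℂ) = ((-l : ℝ) : ℂ) := by push_cast; ring
    rw [this, s1, s2, ← mul_add]
    have hQs : 0 < Q ^ (-s) := Real.rpow_pos_of_pos hQ _
    calc _ ≤ Q ^ (-s) * _ := mul_le_mul_of_nonneg_left hmain hQs.le
      _ = _ := by rw [weight]; ring
  · rw [weight, add_sub_cancel_left, abs_mul, abs_of_pos (by positivity : 0 < l ^ 2)]
    exact hw

/-- The squared Euclidean norm on `ℂ²`. -/
def nsq (v : ℂ × ℂ) : ℝ := Complex.normSq v.1 + Complex.normSq v.2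

/-- The Wronskian of two pairs. -/
def wedge (v w : ℂ × ℂ) : ℂ := v.1 * w.2 - v.2 * w.1

/-- The coefficient along `v` of the orthogonal projection of `w`. -/
def coord (v w : ℂ × ℂ) : ℂ :=
  ((starRingEnd ℂ) v.1 * w.1 + (starRingEnd ℂ) v.2 * w.2) / nsq v

lemma wedge_xfer (t : ℂ) (v w : ℂ × ℂ) : wedge (xfer t v) (xfer t w) = wedge v w := by
  simp only [wedge, xfer]; ring

lemma nsq_eq (v : ℂ × ℂ) : nsq v = ‖v.1‖ ^ 2 + ‖v.2‖ ^ 2 := by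
  simp only [nsq, Complex.normSq_eq_norm_sq]

lemma nsq_cast (v : ℂ × ℂ) :
    (nsq v : ℂ) = v.1 * (starRingEnd ℂ) v.1 + v.2 * (starRingEnd ℂ) v.2 := by
  simp only [nsq, Complex.mul_conj, Complex.ofReal_add]

lemma snd_eq_coord {v : ℂ × ℂ} (hv : v ≠ 0) (w : ℂ × ℂ) :
    w.2 = coord v w * v.2 + wedge v w * (starRingEnd ℂ) v.1 / nsq v := by
  have hn : (nsq v : ℂ) ≠ 0 := by exact_mod_cast (normSq_add_pos hv).ne'
  rw [coord]
  field_simp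
  rw [nsq_cast, wedge]
  ring

lemma coord_xfer_sub {t : ℂ} {v : ℂ × ℂ} (hv : v ≠ 0) (w : ℂ × ℂ) :
    coord (xfer t v) (xfer t w) - coord v w =
      wedge v w / nsq v * (((starRingEnd ℂ) (t * v.1 - v.2) *
        (-(t * (starRingEnd ℂ) v.2) - (starRingEnd ℂ) v.1) -
          (starRingEnd ℂ) v.1 * (starRingEnd ℂ) v.2) / nsq (xfer t v)) := by
  have hn : (nsq v : ℂ) ≠ 0 := by exact_mod_cast (normSq_add_pos hv).ne'
  have hn' : (nsq (xfer t v) : ℂ) ≠ 0 := by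
    exact_mod_cast (normSq_add_pos (xfer_ne_zero t hv)).ne'
  rw [coord, coord]
  field_simp
  rw [nsq_cast, nsq_cast]
  simp only [wedge, xfer, map_sub, map_mul]
  ring

lemma norm_coord_xfer_sub_le {t : ℂ} (ht : ‖t‖ ≤ 4) {v : ℂ × ℂ} (hv : v ≠ 0) (w : ℂ × ℂ) :
    ‖coord (xfer t v) (xfer t w) - coord v w‖ ≤ ‖wedge v w‖ * (26 / nsq (xfer t v)) := by
  have hn : 0 < nsq v := normSq_add_pos hv
  have hn' : 0 < nsq (xfer t v) := normSq_add_pos (xfer_ne_zero t hv)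
  rw [coord_xfer_sub hv, norm_mul, norm_div, norm_div, Complex.norm_of_nonneg hn.le,
    Complex.norm_of_nonneg hn'.le, div_mul_eq_mul_div, div_le_iff₀ hn, mul_assoc]
  refine mul_le_mul_of_nonneg_left ?_ (norm_nonneg _)
  rw [div_mul_eq_mul_div]
  gcongr
  refine (norm_sub_le _ _).trans ?_
  rw [norm_mul, norm_mul, RCLike.norm_conj, RCLike.norm_conj, RCLike.norm_conj]
  have h1 : ‖t * v.1 - v.2‖ ≤ 4 * ‖v.1‖ + ‖v.2‖ := by
    refine (norm_sub_le _ _).trans ?_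
    rw [norm_mul]; gcongr
  have h2 : ‖-(t * (starRingEnd ℂ) v.2) - (starRingEnd ℂ) v.1‖ ≤ 4 * ‖v.2‖ + ‖v.1‖ := by
    refine (norm_sub_le _ _).trans ?_
    rw [norm_neg, norm_mul, RCLike.norm_conj, RCLike.norm_conj]; gcongr
  have h3 := mul_le_mul h1 h2 (norm_nonneg _) (by positivity)
  rw [nsq_eq]
  nlinarith [sq_nonneg (‖v.1‖ - ‖v.2‖), sq_nonneg (‖v.1‖), sq_nonneg ‖v.2‖]

lemma coord_le_sum {t : ℕ → ℂ} (ht : ∀ j, ‖t j‖ ≤ 4) {v w : ℕ → ℂ × ℂ} {m N : ℕ} (hmN : m ≤ N)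
    (hv0 : ∀ j, v j ≠ 0) (hv : ∀ j, v (j + 1) = xfer (t j) (v j))
    (hw : ∀ j, m ≤ j → j < N → w (j + 1) = xfer (t j) (w j)) :
    wedge (v N) (w N) = wedge (v m) (w m) ∧
    ‖coord (v m) (w m)‖ ≤ ‖coord (v N) (w N)‖ +
      ‖wedge (v m) (w m)‖ * ∑ i ∈ Finset.Ioc m N, 26 / nsq (v i) := by
  induction N, hmN using Nat.le_induction with
  | base => simp
  | succ N hmN ih =>
    obtain ⟨h1, h2⟩ := ih fun j hj hj' => hw j hj (by omega)
    have hwN := hw N hmN (by omega)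
    refine ⟨by rw [hv, hwN, wedge_xfer, h1], ?_⟩
    have h3 := norm_coord_xfer_sub_le (ht N) (hv0 N) (w N)
    rw [← hv, ← hwN, h1] at h3
    have h4 := norm_sub_norm_le (coord (v N) (w N)) (coord (v (N + 1)) (w (N + 1)))
    rw [norm_sub_rev] at h4
    rw [← Finset.insert_Ioc_right_eq_Ioc_add_one hmN, Finset.sum_insert (by simp), mul_add]
    linarith

/-- The forward solution of the eigenvalue equation, as pairs of consecutive values. -/
def sol (l : ℝ) (z : ℂ) (τ : ℕ → Bool) : ℕ → ℂ × ℂ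
  | 0 => (1, 0)
  | j + 1 => xfer (z - l * bval (τ j)) (sol l z τ j)

lemma sol_ne_zero (l : ℝ) (z : ℂ) (τ : ℕ → Bool) (j : ℕ) : sol l z τ j ≠ 0 := by
  induction j with
  | zero => simp [sol]
  | succ j ih => exact xfer_ne_zero _ ih

/-- Herglotz property of the Riccati variable. -/
lemma sol_herglotz (l : ℝ) {z : ℂ} (hz : 0 < z.im) (τ : ℕ → Bool) (j : ℕ) :
    (sol l z τ j).1 ≠ 0 ∧ ((sol l z τ j).2 / (sol l z τ j).1).im ≤ 0 ∧
      ‖(sol l z τ j).2‖ * z.im ≤ ‖(sol l z τ j).1‖ := by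
  induction j with
  | zero => simp [sol]
  | succ j ih =>
    obtain ⟨h1, h2, -⟩ := ih
    set v := sol l z τ j with hv
    set t : ℂ := z - l * bval (τ j) - v.2 / v.1 with ht
    have htim : z.im ≤ t.im := by
      have : t.im = z.im - (v.2 / v.1).im := by simp [ht]
      linarith
    have ht0 : t ≠ 0 := by
      intro h; rw [h, Complex.zero_im] at htim; linarith
    have e1 : (sol l z τ (j + 1)).1 = t * v.1 := by
      simp only [sol, xfer, ht, ← hv]; field_simp
    have e2 : (sol l z τ (j + 1)).2 = v.1 := by simp only [sol, xfer, ← hv]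
    rw [e1, e2]
    refine ⟨mul_ne_zero ht0 h1, ?_, ?_⟩
    · have : v.1 / (t * v.1) = t⁻¹ := by field_simp
      rw [this, Complex.inv_im]
      have := Complex.normSq_nonneg t
      exact div_nonpos_of_nonpos_of_nonneg (by linarith) this
    · rw [norm_mul, mul_comm]
      gcongr
      exact htim.trans ((le_abs_self _).trans (Complex.abs_im_le_norm t))

/-- Diagonal Green's function bound through the growth of the forward solution. -/
lemma green_le {l : ℝ} {z : ℂ} (hz : 0 < z.im) {τ : ℕ → Bool}
    (ht : ∀ b, ‖z - l * bval b‖ ≤ 4) {N k : ℕ} (hk : k < N) {g : ℕ → ℂ} (hg0 : g 0 = 0)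
    (hgN : g (N + 1) = 0)
    (hg : ∀ j < N, g (j + 2) = (z - l * bval (τ j)) * g (j + 1) - g j + if j = k then 1 else 0) :
    ‖g (k + 1)‖ ≤ 1 + 26 * ∑ i ∈ Finset.Ioc (k + 1) N,
      nsq (sol l z τ (k + 1)) / nsq (sol l z τ i) +
      z.im⁻¹ * (nsq (sol l z τ (k + 1)) / nsq (sol l z τ N)) := by
  set v := sol l z τ with hv
  set w : ℕ → ℂ × ℂ := fun j => (g (j + 1), g j) with hw
  have hleft : ∀ j ≤ k, g (j + 1) = g 1 * (v j).1 ∧ g j = g 1 * (v j).2 := by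
    intro j
    induction j with
    | zero => intro _; simp [hv, sol, hg0]
    | succ j ih =>
      intro hj
      obtain ⟨h1, h2⟩ := ih (by omega)
      refine ⟨?_, ?_⟩
      · rw [hg j (by omega), if_neg (by omega), h1, h2]
        simp only [hv, sol, xfer]; ring
      · rw [h1]; simp only [hv, sol, xfer]
  obtain ⟨hk1, hk2⟩ := hleft k le_rfl
  have hv2 : (v (k + 1)).2 = (v k).1 := by simp only [hv, sol, xfer]
  have hwk : wedge (v (k + 1)) (w (k + 1)) = -(v (k + 1)).2 := by
    simp only [hw, wedge]
    rw [hg k hk, if_pos rfl, hv2, hk1, hk2]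
    simp only [hv, sol, xfer]
    ring
  have hn : ∀ j, 0 < nsq (v j) := fun j => normSq_add_pos (sol_ne_zero l z τ j)
  obtain ⟨h1, h2⟩ := coord_le_sum (t := fun j => z - l * bval (τ j)) (v := v) (w := w)
    (m := k + 1) (N := N) (fun j => ht _) hk (fun j => sol_ne_zero l z τ j) (fun j => rfl)
    (by
      intro j hj hjN
      simp only [hw, xfer]
      rw [hg j hjN, if_neg (by omega), add_zero])
  obtain ⟨hN1, -, hN3⟩ := sol_herglotz l hz τ N
  rw [← hv] at hN1 hN3
  set β := wedge (v (k + 1)) (w (k + 1)) with hβ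
  have hαN : ‖coord (v N) (w N)‖ ≤ ‖β‖ * (z.im⁻¹ / nsq (v N)) := by
    have e1 : ‖β‖ = ‖(v N).1‖ * ‖g N‖ := by
      rw [← h1]; simp [wedge, hw, hgN]
    have e2 : ‖coord (v N) (w N)‖ = ‖(v N).2‖ * ‖g N‖ / nsq (v N) := by
      simp only [coord, hw, hgN, mul_zero, zero_add]
      rw [norm_div, norm_mul, RCLike.norm_conj, Complex.norm_of_nonneg (hn N).le]
    rw [e1, e2, mul_div_assoc']
    refine div_le_div_of_nonneg_right ?_ (hn N).le
    rw [← div_eq_mul_inv, le_div_iff₀ hz]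
    calc ‖(v N).2‖ * ‖g N‖ * z.im = (‖(v N).2‖ * z.im) * ‖g N‖ := by ring
      _ ≤ _ := by gcongr
  have hsnd := snd_eq_coord (sol_ne_zero l z τ (k + 1)) (w (k + 1))
  rw [← hv, ← hβ] at hsnd
  have hb : ‖β‖ = ‖(v (k + 1)).2‖ := by rw [hwk, norm_neg]
  set n := nsq (v (k + 1)) with hndef
  have hnk : 0 < n := hn (k + 1)
  have hn2 : ‖(v (k + 1)).2‖ ^ 2 ≤ n := by
    rw [hndef, nsq_eq]; nlinarith [sq_nonneg ‖(v (k + 1)).1‖]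
  have hn12 : ‖β‖ * ‖(v (k + 1)).1‖ ≤ n := by
    rw [hndef, nsq_eq, hb]
    nlinarith [sq_nonneg (‖(v (k + 1)).1‖ - ‖(v (k + 1)).2‖), sq_nonneg ‖(v (k + 1)).1‖,
      sq_nonneg ‖(v (k + 1)).2‖]
  have hmain : ‖g (k + 1)‖ ≤ ‖coord (v (k + 1)) (w (k + 1))‖ * ‖(v (k + 1)).2‖ + 1 := by
    have : g (k + 1) = (w (k + 1)).2 := rfl
    rw [this, hsnd]
    refine (norm_add_le _ _).trans ?_
    rw [norm_mul]
    gcongr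
    rw [norm_div, norm_mul, RCLike.norm_conj, Complex.norm_of_nonneg hnk.le, div_le_one hnk]
    exact hn12
  have hS : 0 ≤ ∑ i ∈ Finset.Ioc (k + 1) N, 26 / nsq (v i) :=
    Finset.sum_nonneg fun i _ => (div_pos (by norm_num) (hn i)).le
  have hcoord : ‖coord (v (k + 1)) (w (k + 1))‖ * ‖(v (k + 1)).2‖ ≤
      n * (z.im⁻¹ / nsq (v N) + ∑ i ∈ Finset.Ioc (k + 1) N, 26 / nsq (v i)) := by
    have e1 : ‖coord (v (k + 1)) (w (k + 1))‖ ≤ ‖(v (k + 1)).2‖ *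
        (z.im⁻¹ / nsq (v N) + ∑ i ∈ Finset.Ioc (k + 1) N, 26 / nsq (v i)) := by
      rw [hb] at h2 hαN; linarith
    have e2 : 0 ≤ z.im⁻¹ / nsq (v N) := div_nonneg (inv_nonneg.2 hz.le) (hn N).le
    calc _ ≤ ‖(v (k + 1)).2‖ *
        (z.im⁻¹ / nsq (v N) + ∑ i ∈ Finset.Ioc (k + 1) N, 26 / nsq (v i)) * ‖(v (k + 1)).2‖ := by
          gcongr
      _ = ‖(v (k + 1)).2‖ ^ 2 *
        (z.im⁻¹ / nsq (v N) + ∑ i ∈ Finset.Ioc (k + 1) N, 26 / nsq (v i)) := by ring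
      _ ≤ _ := by gcongr
  have hre : n * (z.im⁻¹ / nsq (v N) + ∑ i ∈ Finset.Ioc (k + 1) N, 26 / nsq (v i)) =
      26 * ∑ i ∈ Finset.Ioc (k + 1) N, n / nsq (v i) + z.im⁻¹ * (n / nsq (v N)) := by
    rw [mul_add, Finset.mul_sum, Finset.mul_sum, add_comm]
    congr 1
    · exact Finset.sum_congr rfl fun i _ => by ring
    · ring
  linarith

/-- Extension of a finite configuration by `false`. -/
def extend {N : ℕ} (σ : Fin N → Bool) (n : ℕ) : Bool := if h : n < N then σ ⟨n, h⟩ else false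

lemma extend_update_of_ne {N : ℕ} (σ : Fin N → Bool) (i : Fin N) (b : Bool) {n : ℕ}
    (hn : n ≠ i) : extend (Function.update σ i b) n = extend σ n := by
  unfold extend
  split_ifs with h
  · rw [Function.update_of_ne]
    intro h'
    exact hn (congrArg Fin.val h')
  · rfl

lemma extend_update_self {N : ℕ} (σ : Fin N → Bool) (i : Fin N) (b : Bool) :
    extend (Function.update σ i b) i = b := by
  simp [extend]

lemma sol_congr (l : ℝ) (z : ℂ) {τ τ' : ℕ → Bool} {j : ℕ} (h : ∀ n < j, τ n = τ' n) :
    sol l z τ j = sol l z τ' j := by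
  induction j with
  | zero => rfl
  | succ j ih => rw [sol, sol, ih fun n hn => h n (by omega), h j (by omega)]

/-- Resampling one coordinate does not change the total sum. -/
lemma sum_resample {N : ℕ} (i : Fin N) (F : (Fin N → Bool) → ℝ) :
    2 * ∑ σ, F σ = ∑ σ, ∑ b : Bool, F (Function.update σ i b) := by
  have hinv : Function.Involutive fun σ : Fin N → Bool => Function.update σ i (!σ i) := by
    intro σ; simp
  have h1 : ∑ σ, F (Function.update σ i (!σ i)) = ∑ σ, F σ :=
    Equiv.sum_comp (Function.Involutive.toPerm _ hinv) F
  have h2 : ∀ σ : Fin N → Bool, ∑ b : Bool, F (Function.update σ i b) =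
      F σ + F (Function.update σ i (!σ i)) := by
    intro σ
    have : F σ = F (Function.update σ i (σ i)) := by rw [Function.update_eq_self]
    rw [this, Fintype.sum_bool]
    cases σ i <;> simp [add_comm]
  simp_rw [h2]
  rw [Finset.sum_add_distrib, h1, two_mul]

/-- Iterating a one-step contraction of a Lyapunov function along the random dynamics. -/
lemma sum_lyapunov_le {l ρ : ℝ} {z : ℂ} {φ : ℂ × ℂ → ℝ} {θ : ℂ × ℂ → ℝ} (hρ : 0 ≤ ρ)
    (hθ : ∀ v ≠ 0, 0 ≤ θ v)
    (hφ : ∀ v ≠ 0, ∑ b : Bool, φ (xfer (z - l * bval b) v) ≤ 2 * ρ * φ v)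
    (hθφ : ∀ v ≠ 0, θ v * φ v ≤ 3 / 2) {N k i : ℕ} (hki : k ≤ i) (hiN : i ≤ N) :
    ∑ σ : Fin N → Bool, θ (sol l z (extend σ) k) * φ (sol l z (extend σ) i) ≤
      3 / 2 * ρ ^ (i - k) * 2 ^ N := by
  induction i, hki using Nat.le_induction with
  | base =>
    refine (Finset.sum_le_sum fun σ _ => hθφ _ (sol_ne_zero l z (extend σ) k)).trans_eq ?_
    simp [mul_comm]
  | succ i hki ih =>
    have hi : i < N := hiN
    have key := sum_resample ⟨i, hi⟩ fun σ : Fin N → Bool =>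
      θ (sol l z (extend σ) k) * φ (sol l z (extend σ) (i + 1))
    have step : ∀ σ : Fin N → Bool, ∑ b : Bool,
        θ (sol l z (extend (Function.update σ ⟨i, hi⟩ b)) k) *
          φ (sol l z (extend (Function.update σ ⟨i, hi⟩ b)) (i + 1)) ≤
        2 * ρ * (θ (sol l z (extend σ) k) * φ (sol l z (extend σ) i)) := by
      intro σ
      have e : ∀ b : Bool, θ (sol l z (extend (Function.update σ ⟨i, hi⟩ b)) k) *
          φ (sol l z (extend (Function.update σ ⟨i, hi⟩ b)) (i + 1)) =
          θ (sol l z (extend σ) k) * φ (xfer (z - l * bval b) (sol l z (extend σ) i)) := by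
        intro b
        have e1 : ∀ j ≤ i, sol l z (extend (Function.update σ ⟨i, hi⟩ b)) j =
            sol l z (extend σ) j := fun j hj =>
          sol_congr l z fun n hn => extend_update_of_ne σ ⟨i, hi⟩ b (by simp; omega)
        have e2 : extend (Function.update σ ⟨i, hi⟩ b) i = b :=
          extend_update_self σ ⟨i, hi⟩ b
        rw [e1 k hki, sol, e1 i le_rfl, e2]
      simp_rw [e]
      rw [← Finset.mul_sum]
      have h0 := sol_ne_zero l z (extend σ) i
      have h1 := hθ _ (sol_ne_zero l z (extend σ) k)
      calc _ ≤ θ (sol l z (extend σ) k) * (2 * ρ * φ (sol l z (extend σ) i)) :=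
            mul_le_mul_of_nonneg_left (hφ _ h0) h1
        _ = _ := by ring
    have h2 := Finset.sum_le_sum fun σ (_ : σ ∈ Finset.univ) => step σ
    rw [← key, ← Finset.mul_sum] at h2
    have h3 := mul_le_mul_of_nonneg_left (ih (by omega)) hρ
    rw [Nat.succ_sub hki, pow_succ]
    linarith

/-- Mean growth of the forward solution. -/
lemma sum_rpow_nsq_div_le {δ s l ρ E : ℝ} {z : ℂ} (hδ : 0 < δ) (hδ1 : δ < 1) (hs : 0 < s)
    (hs1 : s < 1) (hE : |E| < 2 - δ) (hρ : 0 ≤ ρ)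
    (hc : ∀ v ≠ 0, (∑ b : Bool, qform E (xfer (z - l * bval b) v) ^ (-s) *
      weight s E l (xfer (z - l * bval b) v)) ≤ 2 * ρ * (qform E v ^ (-s) * weight s E l v) ∧
      |weight s E l v - 1| ≤ 1 / 2) {N k i : ℕ} (hki : k ≤ i) (hiN : i ≤ N) :
    ∑ σ : Fin N → Bool, (nsq (sol l z (extend σ) k) / nsq (sol l z (extend σ) i)) ^ s ≤
      12 / δ * ρ ^ (i - k) * 2 ^ N := by
  have hq : ∀ v ≠ 0, 0 < qform E v := fun v hv => qform_pos hδ hE hv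
  have h1 := sum_lyapunov_le (l := l) (z := z) (θ := fun v => qform E v ^ s)
    (φ := fun v => qform E v ^ (-s) * weight s E l v) hρ
    (fun v hv => (Real.rpow_pos_of_pos (hq v hv) s).le) (fun v hv => (hc v hv).1)
    (fun v hv => by
      have := (abs_le.1 (hc v hv).2).2
      rw [← mul_assoc, ← Real.rpow_add (hq v hv), add_neg_cancel, Real.rpow_zero]
      linarith) hki hiN
  have hpt : ∀ σ : Fin N → Bool,
      (nsq (sol l z (extend σ) k) / nsq (sol l z (extend σ) i)) ^ s ≤
      8 / δ * (qform E (sol l z (extend σ) k) ^ s * (qform E (sol l z (extend σ) i) ^ (-s) *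
        weight s E l (sol l z (extend σ) i))) := by
    intro σ
    set a := sol l z (extend σ) k
    set b := sol l z (extend σ) i
    have ha : a ≠ 0 := sol_ne_zero _ _ _ _
    have hb : b ≠ 0 := sol_ne_zero _ _ _ _
    have hqa := hq a ha
    have hqb := hq b hb
    have hna : 0 < nsq a := normSq_add_pos ha
    have hnb : 0 < nsq b := normSq_add_pos hb
    have hw := (abs_le.1 (hc b hb).2).1
    have e1 : nsq a / nsq b ≤ 4 / δ * (qform E a / qform E b) := by
      have h2 : δ / 2 * nsq a ≤ qform E a := le_qform hE a
      have h3 : qform E b ≤ 2 * nsq b := qform_le (by linarith) b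
      rw [div_mul_div_comm, div_le_div_iff₀ hnb (by positivity)]
      calc nsq a * (δ * qform E b) ≤ nsq a * (δ * (2 * nsq b)) := by gcongr
        _ = 4 * (δ / 2 * nsq a) * nsq b := by ring
        _ ≤ _ := by gcongr
    have e2 : (4 / δ) ^ s ≤ 4 / δ := by
      have : (1 : ℝ) ≤ 4 / δ := by rw [le_div_iff₀ hδ]; linarith
      calc (4 / δ) ^ s ≤ (4 / δ) ^ (1 : ℝ) := Real.rpow_le_rpow_of_exponent_le this hs1.le
        _ = _ := Real.rpow_one _
    have e3 : (qform E a / qform E b) ^ s = qform E a ^ s * qform E b ^ (-s) := by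
      rw [Real.div_rpow hqa.le hqb.le, Real.rpow_neg hqb.le, div_eq_mul_inv]
    have e4 : 0 < qform E a ^ s * qform E b ^ (-s) := by positivity
    calc (nsq a / nsq b) ^ s ≤ (4 / δ * (qform E a / qform E b)) ^ s :=
          Real.rpow_le_rpow (by positivity) e1 hs.le
      _ = (4 / δ) ^ s * (qform E a ^ s * qform E b ^ (-s)) := by
          rw [Real.mul_rpow (by positivity) (by positivity), e3]
      _ ≤ 4 / δ * (qform E a ^ s * qform E b ^ (-s)) := by gcongr
      _ ≤ 4 / δ * (qform E a ^ s * qform E b ^ (-s) * (2 * weight s E l b)) := by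
          refine mul_le_mul_of_nonneg_left ?_ (by positivity)
          exact le_mul_of_one_le_right e4.le (by linarith)
      _ = _ := by ring
  refine (Finset.sum_le_sum fun σ _ => hpt σ).trans ?_
  rw [← Finset.mul_sum]
  refine (mul_le_mul_of_nonneg_left h1 (by positivity)).trans_eq ?_
  ring

lemma rpow_sum_le_sum_rpow {ι : Type*} (t : Finset ι) {f : ι → ℝ} (hf : ∀ i, 0 ≤ f i) {s : ℝ}
    (hs : 0 < s) (hs1 : s ≤ 1) : (∑ i ∈ t, f i) ^ s ≤ ∑ i ∈ t, f i ^ s := by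
  classical
  induction t using Finset.induction_on with
  | empty => simp [Real.zero_rpow hs.ne']
  | insert a t ha ih =>
    rw [Finset.sum_insert ha, Finset.sum_insert ha]
    refine (Real.rpow_add_le_add_rpow (hf a) (Finset.sum_nonneg fun i _ => hf i) hs.le hs1).trans ?_
    gcongr

/-- Averaged fractional moment bound for the diagonal Green's function. -/
lemma sum_green_rpow_le {δ s l ρ E : ℝ} {z : ℂ} (hδ : 0 < δ) (hδ1 : δ < 1) (hs : 0 < s)
    (hs1 : s < 1) (hE : |E| < 2 - δ) (hρ : 0 ≤ ρ) (hρ1 : ρ < 1) (hz : 0 < z.im)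
    (ht : ∀ b, ‖z - l * bval b‖ ≤ 4)
    (hc : ∀ v ≠ 0, (∑ b : Bool, qform E (xfer (z - l * bval b) v) ^ (-s) *
      weight s E l (xfer (z - l * bval b) v)) ≤ 2 * ρ * (qform E v ^ (-s) * weight s E l v) ∧
      |weight s E l v - 1| ≤ 1 / 2) {N k : ℕ} (hk : k < N) {g : (Fin N → Bool) → ℕ → ℂ}
    (hg0 : ∀ σ, g σ 0 = 0) (hgN : ∀ σ, g σ (N + 1) = 0)
    (hg : ∀ σ, ∀ j < N, g σ (j + 2) =
      (z - l * bval (extend σ j)) * g σ (j + 1) - g σ j + if j = k then 1 else 0) :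
    ∑ σ, ‖g σ (k + 1)‖ ^ s ≤ 2 ^ N * (1 + 26 * (12 / δ) / (1 - ρ) +
      z.im⁻¹ ^ s * (12 / δ) * ρ ^ (N - (k + 1))) := by
  set r : (Fin N → Bool) → ℕ → ℝ := fun σ i =>
    nsq (sol l z (extend σ) (k + 1)) / nsq (sol l z (extend σ) i) with hr
  have hn : ∀ σ : Fin N → Bool, ∀ j, 0 < nsq (sol l z (extend σ) j) :=
    fun σ j => normSq_add_pos (sol_ne_zero l z _ j)
  have hr0 : ∀ σ i, 0 ≤ r σ i := fun σ i => (div_pos (hn σ _) (hn σ i)).le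
  have h26 : (26 : ℝ) ^ s ≤ 26 := by
    calc (26 : ℝ) ^ s ≤ 26 ^ (1 : ℝ) := Real.rpow_le_rpow_of_exponent_le (by norm_num) hs1.le
      _ = _ := Real.rpow_one _
  have hpt : ∀ σ, ‖g σ (k + 1)‖ ^ s ≤ 1 + 26 * ∑ i ∈ Finset.Ioc (k + 1) N, r σ i ^ s +
      z.im⁻¹ ^ s * r σ N ^ s := by
    intro σ
    have h1 := green_le hz ht hk (hg0 σ) (hgN σ) (hg σ)
    have hS : 0 ≤ ∑ i ∈ Finset.Ioc (k + 1) N, r σ i := Finset.sum_nonneg fun i _ => hr0 σ i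
    have hzi : 0 ≤ z.im⁻¹ := inv_nonneg.2 hz.le
    have hzr : 0 ≤ z.im⁻¹ * r σ N := mul_nonneg hzi (hr0 σ N)
    refine (Real.rpow_le_rpow (norm_nonneg _) h1 hs.le).trans ?_
    refine (Real.rpow_add_le_add_rpow (by positivity) hzr hs.le hs1.le).trans ?_
    rw [Real.mul_rpow hzi (hr0 σ N)]
    refine add_le_add_left ?_ _
    refine (Real.rpow_add_le_add_rpow zero_le_one (by positivity) hs.le hs1.le).trans ?_
    rw [Real.one_rpow, Real.mul_rpow (by norm_num) hS]
    have h2 := rpow_sum_le_sum_rpow (Finset.Ioc (k + 1) N) (hr0 σ) hs hs1.le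
    gcongr
  have hav : ∀ i, k + 1 ≤ i → i ≤ N → ∑ σ, r σ i ^ s ≤ 12 / δ * ρ ^ (i - (k + 1)) * 2 ^ N :=
    fun i hi hiN => sum_rpow_nsq_div_le hδ hδ1 hs hs1 hE hρ hc hi hiN
  have hgeo : ∑ i ∈ Finset.Ioc (k + 1) N, ρ ^ (i - (k + 1)) ≤ 1 / (1 - ρ) := by
    have e : ∑ i ∈ Finset.Ioc (k + 1) N, ρ ^ (i - (k + 1)) ≤
        ∑ i ∈ Finset.range (N + 1), ρ ^ i := by
      rw [← Finset.sum_image (s := Finset.Ioc (k + 1) N) (g := fun i => i - (k + 1))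
        (f := fun i => ρ ^ i)]
      · refine Finset.sum_le_sum_of_subset_of_nonneg ?_ fun i _ _ => by positivity
        intro i hi
        simp only [Finset.mem_image, Finset.mem_Ioc, Finset.mem_range] at hi ⊢
        omega
      · intro a ha b hb hab
        simp only [Finset.coe_Ioc, Set.mem_Ioc] at ha hb hab
        omega
    refine e.trans ?_
    rw [geom_sum_eq hρ1.ne, ← neg_div_neg_eq, neg_sub, neg_sub]
    refine div_le_div_of_nonneg_right ?_ (by linarith)
    have := pow_nonneg hρ (N + 1)
    linarith
  calc ∑ σ, ‖g σ (k + 1)‖ ^ s ≤ ∑ σ, (1 + 26 * ∑ i ∈ Finset.Ioc (k + 1) N, r σ i ^ s +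
        z.im⁻¹ ^ s * r σ N ^ s) := Finset.sum_le_sum fun σ _ => hpt σ
    _ = 2 ^ N + 26 * ∑ i ∈ Finset.Ioc (k + 1) N, ∑ σ, r σ i ^ s +
        z.im⁻¹ ^ s * ∑ σ, r σ N ^ s := by
      rw [Finset.sum_add_distrib, Finset.sum_add_distrib, ← Finset.mul_sum, ← Finset.mul_sum,
        Finset.sum_comm]
      simp
    _ ≤ 2 ^ N + 26 * ∑ i ∈ Finset.Ioc (k + 1) N, 12 / δ * ρ ^ (i - (k + 1)) * 2 ^ N +
        z.im⁻¹ ^ s * (12 / δ * ρ ^ (N - (k + 1)) * 2 ^ N) := by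
      have hzs : 0 ≤ z.im⁻¹ ^ s := Real.rpow_nonneg (inv_nonneg.2 hz.le) s
      gcongr with i hi
      · rw [Finset.mem_Ioc] at hi
        exact hav i hi.1.le hi.2
      · exact hav N hk le_rfl
    _ ≤ 2 ^ N + 26 * (12 / δ * (1 / (1 - ρ)) * 2 ^ N) +
        z.im⁻¹ ^ s * (12 / δ * ρ ^ (N - (k + 1)) * 2 ^ N) := by
      rw [← Finset.sum_mul, ← Finset.mul_sum]
      gcongr
    _ = _ := by ring

open Matrix in
/-- Real form of the spectral theorem for symmetric matrices. -/
lemma exists_orthogonal_diagonalization {n : Type*} [Fintype n] [DecidableEq n]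
    {A : Matrix n n ℝ} (h : A.IsHermitian) : ∃ P : Matrix n n ℝ, P * Pᵀ = 1 ∧ Pᵀ * P = 1 ∧
      A = P * diagonal h.eigenvalues * Pᵀ := by
  refine ⟨h.eigenvectorUnitary, ?_, ?_, ?_⟩
  · have := (Matrix.mem_unitaryGroup_iff (A := (h.eigenvectorUnitary : Matrix n n ℝ))).1
      h.eigenvectorUnitary.2
    rwa [star_eq_conjTranspose, conjTranspose_eq_transpose_of_trivial] at this
  · have := (Matrix.mem_unitaryGroup_iff' (A := (h.eigenvectorUnitary : Matrix n n ℝ))).1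
      h.eigenvectorUnitary.2
    rwa [star_eq_conjTranspose, conjTranspose_eq_transpose_of_trivial] at this
  · have := h.spectral_theorem
    rw [Unitary.conjStarAlgAut_apply, star_eq_conjTranspose,
      conjTranspose_eq_transpose_of_trivial] at this
    exact this

open Matrix in
/-- The resolvent of a symmetric matrix off the real axis controls the number of eigenvalues in
an interval. -/
lemma exists_green {n : Type*} [Fintype n] [DecidableEq n] {A : Matrix n n ℝ}
    (h : A.IsHermitian) (E : ℝ) {η : ℝ} (hη : 0 < η) : ∃ G : n → n → ℂ,
      (∀ i k, ∑ m, (A i m : ℂ) * G m k = (E + η * Complex.I) * G i k + if i = k then 1 else 0) ∧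
      (∀ k, η * ‖G k k‖ ≤ 1) ∧
      ((Finset.univ.filter fun j => E - η < h.eigenvalues j ∧ h.eigenvalues j ≤ E + η).card : ℝ) ≤
        2 * η * ∑ k, ‖G k k‖ := by
  obtain ⟨P, hP1, hP2, hA⟩ := exists_orthogonal_diagonalization h
  set μ := h.eigenvalues
  set z : ℂ := E + η * Complex.I with hz
  have hzim : z.im = η := by simp [hz]
  have hzre : z.re = E := by simp [hz]
  have hne : ∀ j, (μ j : ℂ) - z ≠ 0 := by
    intro j hj
    have := congrArg Complex.im hj
    rw [Complex.sub_im, hzim, Complex.ofReal_im, Complex.zero_im] at this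
    linarith
  have hrow : ∀ i k, ∑ j, P i j * P k j = if i = k then 1 else 0 := by
    intro i k
    have := congrFun (congrFun hP1 i) k
    rw [mul_apply, one_apply] at this
    exact this
  have hAP : A * P = P * diagonal μ := by
    rw [hA, mul_assoc, hP2, mul_one]
  have heig : ∀ i j, ∑ m, A i m * P m j = P i j * μ j := by
    intro i j
    have := congrFun (congrFun hAP i) j
    rwa [mul_apply, mul_diagonal] at this
  have hdiag : ∀ k, ∑ j, (P k j : ℂ) * P k j / (μ j - z) =
      ∑ j, ((P k j ^ 2 : ℝ) : ℂ) * (μ j - z)⁻¹ := by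
    intro k
    refine Finset.sum_congr rfl fun j _ => ?_
    push_cast
    rw [div_eq_mul_inv, sq]
  refine ⟨fun i k => ∑ j, (P i j : ℂ) * P k j / (μ j - z), ?_, ?_, ?_⟩
  · intro i k
    have hik : (if i = k then (1 : ℂ) else 0) = ∑ j, (P i j : ℂ) * P k j := by
      have := congrArg (Complex.ofReal) (hrow i k)
      push_cast at this
      rw [this]
      split_ifs <;> simp
    rw [hik, Finset.mul_sum, ← Finset.sum_add_distrib]
    simp_rw [Finset.mul_sum]
    rw [Finset.sum_comm]
    refine Finset.sum_congr rfl fun j _ => ?_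
    have h1 : ∑ m, (A i m : ℂ) * P m j = P i j * μ j := by
      exact_mod_cast congrArg (Complex.ofReal) (heig i j)
    calc ∑ m, (A i m : ℂ) * (P m j * P k j / (μ j - z)) =
        (∑ m, (A i m : ℂ) * P m j) * (P k j / (μ j - z)) := by
          rw [Finset.sum_mul]
          exact Finset.sum_congr rfl fun m _ => by ring
      _ = _ := by
          rw [h1]
          have := hne j
          field_simp
          ring
  · intro k
    simp only [hdiag]
    have h1 : ‖∑ j, ((P k j ^ 2 : ℝ) : ℂ) * ((μ j : ℂ) - z)⁻¹‖ ≤ ∑ j, P k j ^ 2 * η⁻¹ := by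
      refine (norm_sum_le _ _).trans (Finset.sum_le_sum fun j _ => ?_)
      rw [norm_mul, Complex.norm_of_nonneg (sq_nonneg _), norm_inv]
      gcongr
      have := Complex.abs_im_le_norm ((μ j : ℂ) - z)
      rw [Complex.sub_im, hzim, Complex.ofReal_im, zero_sub, abs_neg, abs_of_pos hη] at this
      exact this
    have h2 : ∑ j, P k j ^ 2 = 1 := by
      simpa [sq] using hrow k k
    rw [← Finset.sum_mul, h2, one_mul] at h1
    calc η * _ ≤ η * η⁻¹ := by gcongr
      _ = 1 := mul_inv_cancel₀ hη.ne'
  · have hcol : ∀ j, ∑ k, P k j ^ 2 = 1 := by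
      intro j
      have := congrFun (congrFun hP2 j) j
      rw [mul_apply, one_apply, if_pos rfl] at this
      simpa [sq] using this
    have him : ∀ j, (((μ j : ℂ) - z)⁻¹).im = η / ((μ j - E) ^ 2 + η ^ 2) := by
      intro j
      rw [Complex.inv_im, Complex.normSq_apply, Complex.sub_im, Complex.sub_re, hzim, hzre,
        Complex.ofReal_im, Complex.ofReal_re]
      congr 1 <;> ring
    have h1 : ∑ j, η / ((μ j - E) ^ 2 + η ^ 2) ≤
        ∑ k, ‖∑ j, (P k j : ℂ) * P k j / (μ j - z)‖ := by
      calc ∑ j, η / ((μ j - E) ^ 2 + η ^ 2) =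
          ∑ j, ∑ k, P k j ^ 2 * (η / ((μ j - E) ^ 2 + η ^ 2)) := by
            refine Finset.sum_congr rfl fun j _ => ?_
            rw [← Finset.sum_mul, hcol, one_mul]
        _ = ∑ k, ∑ j, P k j ^ 2 * (η / ((μ j - E) ^ 2 + η ^ 2)) := Finset.sum_comm
        _ ≤ _ := by
            refine Finset.sum_le_sum fun k _ => ?_
            rw [hdiag]
            refine le_trans (le_of_eq ?_) ((le_abs_self _).trans (Complex.abs_im_le_norm _))
            rw [Complex.im_sum]
            refine Finset.sum_congr rfl fun j _ => ?_
            rw [Complex.im_ofReal_mul, him]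
    have h2 : ((Finset.univ.filter fun j => E - η < μ j ∧ μ j ≤ E + η).card : ℝ) ≤
        ∑ j, 2 * η * (η / ((μ j - E) ^ 2 + η ^ 2)) := by
      rw [Finset.card_eq_sum_ones, Nat.cast_sum]
      refine (Finset.sum_le_sum fun j hj => ?_).trans
        (Finset.sum_le_sum_of_subset_of_nonneg (Finset.filter_subset _ _)
          fun j _ _ => by positivity)
      rw [Finset.mem_filter] at hj
      obtain ⟨-, h3, h4⟩ := hj
      have h5 : (μ j - E) ^ 2 ≤ η ^ 2 := sq_le_sq' (by linarith) (by linarith)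
      rw [Nat.cast_one, mul_div_assoc', le_div_iff₀ (by positivity)]
      linarith
    rw [← Finset.mul_sum] at h2
    exact h2.trans (by gcongr)

lemma isHermitian_HN (lam : ℝ) (N : ℕ) (σ : Fin N → Bool) : (HN lam N σ).IsHermitian := by
  refine Matrix.IsHermitian.ext fun i j => ?_
  simp only [HN, Matrix.of_apply, star_trivial]
  by_cases h : i = j
  · subst h; rfl
  · rw [if_neg h, if_neg (Ne.symm h)]
    simp only [or_comm]

lemma eigCount_eq (lam : ℝ) (N : ℕ) (σ : Fin N → Bool) (E : ℝ) : eigCount lam N σ E =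
    (Finset.univ.filter fun j => (isHermitian_HN lam N σ).eigenvalues j ≤ E).card := by
  classical
  rw [eigCount, dif_pos (isHermitian_HN lam N σ)]

lemma sum_HN_mul (lam : ℝ) {N : ℕ} (σ : Fin N → Bool) {g : ℕ → ℂ} (hg0 : g 0 = 0)
    (hgN : g (N + 1) = 0) (i : Fin N) :
    ∑ m, (HN lam N σ i m : ℂ) * g (m + 1) =
      lam * bval (σ i) * g (i + 1) + g i + g (i + 2) := by
  have e : ∀ m : Fin N, (HN lam N σ i m : ℂ) * g (m + 1) =
      (if i = m then lam * bval (σ i) * g (m + 1) else 0) +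
      (if (m : ℕ) + 1 = i then g (m + 1) else 0) +
      (if (i : ℕ) + 1 = m then g (m + 1) else 0) := by
    intro m
    by_cases h1 : i = m
    · subst h1; simp [HN]
    · by_cases h2 : (m : ℕ) + 1 = i
      · have h3 : ¬ (i : ℕ) + 1 = m := by omega
        simp [HN, h1, h2, h3]
      · by_cases h3 : (i : ℕ) + 1 = m <;> simp [HN, h1, h2, h3]
  simp_rw [e]
  rw [Finset.sum_add_distrib, Finset.sum_add_distrib, Finset.sum_ite_eq, if_pos (Finset.mem_univ _)]
  congr 1
  · congr 1
    rw [Fin.sum_univ_eq_sum_range (fun m => if m + 1 = (i : ℕ) then g (m + 1) else 0)]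
    obtain ⟨i, hi⟩ := i
    cases i with
    | zero => simp [hg0]
    | succ i =>
      simp only [Nat.add_right_cancel_iff, Finset.sum_ite_eq', Finset.mem_range]
      rw [if_pos (by omega)]
  · rw [Fin.sum_univ_eq_sum_range (fun m => if (i : ℕ) + 1 = m then g (m + 1) else 0),
      Finset.sum_ite_eq]
    split_ifs with h
    · rfl
    · rw [Finset.mem_range] at h
      have : (i : ℕ) + 2 = N + 1 := by omega
      rw [this, hgN]

lemma eigCount_mono (lam : ℝ) (N : ℕ) (σ : Fin N → Bool) : Monotone (eigCount lam N σ) := by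
  intro E E' h
  rw [eigCount_eq, eigCount_eq]
  exact Finset.card_le_card (Finset.monotone_filter_right _ fun j _ hj => hj.trans h)

lemma eigCount_le (lam : ℝ) (N : ℕ) (σ : Fin N → Bool) (E : ℝ) : eigCount lam N σ E ≤ N := by
  rw [eigCount_eq]
  exact (Finset.card_le_univ _).trans_eq (Fintype.card_fin N)

/-- The eigenvalue count of an interval is bounded by solutions of the Green's function equation. -/
lemma exists_green_HN (lam : ℝ) (N : ℕ) (σ : Fin N → Bool) (E : ℝ) {η : ℝ} (hη : 0 < η) :
    ∃ g : ℕ → ℕ → ℂ, (∀ k, g k 0 = 0) ∧ (∀ k, g k (N + 1) = 0) ∧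
      (∀ k < N, ∀ j < N, g k (j + 2) = (E + η * Complex.I - lam * bval (extend σ j)) *
        g k (j + 1) - g k j + if j = k then 1 else 0) ∧
      (∀ k < N, η * ‖g k (k + 1)‖ ≤ 1) ∧
      (eigCount lam N σ (E + η) : ℝ) - eigCount lam N σ (E - η) ≤
        2 * η * ∑ k ∈ Finset.range N, ‖g k (k + 1)‖ := by
  obtain ⟨G, hG1, hG2, hG3⟩ := exists_green (isHermitian_HN lam N σ) E hη
  set g : ℕ → ℕ → ℂ := fun k j =>
    if h : k < N ∧ 0 < j ∧ j - 1 < N then G ⟨j - 1, h.2.2⟩ ⟨k, h.1⟩ else 0 with hg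
  have hgG : ∀ i k : Fin N, g k (i + 1) = G i k := by
    intro i k
    simp [hg]
  have hg0 : ∀ k, g k 0 = 0 := by intro k; simp [hg]
  have hgN : ∀ k, g k (N + 1) = 0 := by intro k; simp [hg]
  refine ⟨g, hg0, hgN, ?_, ?_, ?_⟩
  · intro k hk j hj
    have h1 := hG1 ⟨j, hj⟩ ⟨k, hk⟩
    have h2 := sum_HN_mul lam σ (hg0 k) (hgN k) ⟨j, hj⟩
    have h3 : ∀ m : Fin N, g k (m + 1) = G m ⟨k, hk⟩ := fun m => hgG m ⟨k, hk⟩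
    simp_rw [h3] at h2
    rw [h1] at h2
    have h4 : extend σ j = σ ⟨j, hj⟩ := by simp [extend, hj]
    have h5 : g k (j + 1) = G ⟨j, hj⟩ ⟨k, hk⟩ := h3 ⟨j, hj⟩
    rw [h4, h5]
    simp only [Fin.mk.injEq, h5] at h2
    linear_combination -h2
  · intro k hk
    have := hG2 ⟨k, hk⟩
    rwa [← hgG] at this
  · have e1 : ∑ k ∈ Finset.range N, ‖g k (k + 1)‖ = ∑ k, ‖G k k‖ := by
      rw [← Fin.sum_univ_eq_sum_range (fun k => ‖g k (k + 1)‖)]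
      exact Finset.sum_congr rfl fun k _ => by rw [hgG]
    rw [e1]
    refine le_trans ?_ hG3
    rw [eigCount_eq, eigCount_eq, sub_le_iff_le_add, ← Nat.cast_add, Nat.cast_le,
      ← Finset.card_union_of_disjoint]
    · refine Finset.card_le_card fun j hj => ?_
      simp only [Finset.mem_filter, Finset.mem_union, Finset.mem_univ, true_and] at hj ⊢
      by_cases h : E - η < (isHermitian_HN lam N σ).eigenvalues j
      · exact Or.inl ⟨h, hj⟩
      · exact Or.inr (not_lt.1 h)
    · rw [Finset.disjoint_left]
      intro j hj hj'
      simp only [Finset.mem_filter, Finset.mem_univ, true_and] at hj hj'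
      linarith [hj.1]

open Matrix in
/-- There is a space of dimension the number of eigenvalues `≤ E` on which the form is `≤ E`. -/
lemma exists_linearMap_form_le {n : Type*} [Fintype n] [DecidableEq n] {A : Matrix n n ℝ}
    (h : A.IsHermitian) (E : ℝ) : ∃ T : ({j // h.eigenvalues j ≤ E} → ℝ) →ₗ[ℝ] (n → ℝ),
      Function.Injective T ∧ ∀ c, T c ⬝ᵥ A *ᵥ T c ≤ E * (T c ⬝ᵥ T c) := by
  obtain ⟨P, -, hP2, hA⟩ := exists_orthogonal_diagonalization h
  set μ := h.eigenvalues
  let S : ({j // μ j ≤ E} → ℝ) →ₗ[ℝ] (n → ℝ) :=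
    { toFun := fun c j => if hj : μ j ≤ E then c ⟨j, hj⟩ else 0
      map_add' := fun c d => by ext j; by_cases hj : μ j ≤ E <;> simp [hj]
      map_smul' := fun r c => by ext j; by_cases hj : μ j ≤ E <;> simp [hj] }
  have hS : ∀ c j, E < μ j → S c j = 0 := fun c j hj => dif_neg (not_le.2 hj)
  have hP : ∀ x, Pᵀ *ᵥ (P *ᵥ x) = x := fun x => by rw [mulVec_mulVec, hP2, one_mulVec]
  have hdot : ∀ x y, P *ᵥ x ⬝ᵥ P *ᵥ y = x ⬝ᵥ y := fun x y => by
    rw [dotProduct_mulVec, ← mulVec_transpose, hP]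
  refine ⟨(mulVecLin P).comp S, fun c d hcd => ?_, fun c => ?_⟩
  · have h1 : S c = S d := by
      rw [← hP (S c), ← hP (S d)]
      exact congrArg (Pᵀ *ᵥ ·) hcd
    ext j
    have := congrFun h1 j
    simpa [S, j.2] using this
  · have h1 : A *ᵥ (P *ᵥ S c) = P *ᵥ (diagonal μ *ᵥ S c) := by
      rw [hA, ← mulVec_mulVec, ← mulVec_mulVec, hP]
    simp only [LinearMap.comp_apply, mulVecLin_apply]
    rw [h1, hdot, hdot, dotProduct, dotProduct, Finset.mul_sum]
    refine Finset.sum_le_sum fun j _ => ?_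
    rw [mulVec_diagonal]
    rcases le_or_gt (μ j) E with hj | hj
    · nlinarith [mul_self_nonneg (S c j)]
    · rw [hS c j hj]; simp

open Matrix in
/-- Min-max bound: a space on which the form is `≤ E`, up to one linear constraint, has dimension
at most one more than the number of eigenvalues `≤ E`. -/
lemma finrank_le_card_eigenvalues_add_one {n : Type*} [Fintype n] [DecidableEq n]
    {A : Matrix n n ℝ} (h : A.IsHermitian) (E : ℝ) {X : Type*} [AddCommGroup X] [Module ℝ X]
    (T : X →ₗ[ℝ] (n → ℝ)) (hT : Function.Injective T) (f : X →ₗ[ℝ] ℝ)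
    (hf : ∀ x, f x = 0 → T x ⬝ᵥ A *ᵥ T x ≤ E * (T x ⬝ᵥ T x)) :
    Module.finrank ℝ X ≤ Fintype.card {j // h.eigenvalues j ≤ E} + 1 := by
  obtain ⟨P, hP1, -, hA⟩ := exists_orthogonal_diagonalization h
  set μ := h.eigenvalues
  let L : X →ₗ[ℝ] ({j // μ j ≤ E} → ℝ) × ℝ :=
    ((LinearMap.funLeft ℝ ℝ Subtype.val).comp ((mulVecLin Pᵀ).comp T)).prod f
  have hL : Function.Injective L := by
    rw [← LinearMap.ker_eq_bot, LinearMap.ker_eq_bot']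
    intro x hx
    have hx1 : ∀ j, μ j ≤ E → (Pᵀ *ᵥ T x) j = 0 := fun j hj =>
      congrFun (congrArg Prod.fst hx) ⟨j, hj⟩
    have hx2 : f x = 0 := congrArg Prod.snd hx
    have hfx := hf x hx2
    set y := Pᵀ *ᵥ T x with hy
    have hTy : T x = P *ᵥ y := by rw [hy, mulVec_mulVec, hP1, one_mulVec]
    have e1 : T x ⬝ᵥ A *ᵥ T x = ∑ j, μ j * y j ^ 2 := by
      rw [hA, ← mulVec_mulVec, ← mulVec_mulVec, ← hy, dotProduct_mulVec, ← mulVec_transpose, ← hy,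
        dotProduct]
      refine Finset.sum_congr rfl fun j _ => ?_
      rw [mulVec_diagonal]; ring
    have e2 : T x ⬝ᵥ T x = ∑ j, y j ^ 2 := by
      nth_rewrite 2 [hTy]
      rw [dotProduct_mulVec, ← mulVec_transpose, ← hy, dotProduct]
      exact Finset.sum_congr rfl fun j _ => (sq _).symm
    rw [e1, e2, Finset.mul_sum] at hfx
    have hle : ∀ j ∈ Finset.univ, E * y j ^ 2 ≤ μ j * y j ^ 2 := by
      intro j _
      rcases le_or_gt (μ j) E with hj | hj
      · rw [hx1 j hj]; simp
      · gcongr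
    have heq := (Finset.sum_eq_sum_iff_of_le hle).1 (le_antisymm (Finset.sum_le_sum hle) hfx)
    have hy0 : y = 0 := by
      ext j
      rcases le_or_gt (μ j) E with hj | hj
      · exact hx1 j hj
      · have h1 := heq j (Finset.mem_univ j)
        have h2 : (μ j - E) * y j ^ 2 = 0 := by linarith
        rcases mul_eq_zero.1 h2 with h3 | h3
        · linarith
        · simpa using h3
    rw [hy0, mulVec_zero] at hTy
    exact hT (hTy.trans (map_zero T).symm)
  have := LinearMap.finrank_le_finrank_of_injective hL
  rwa [Module.finrank_prod, Module.finrank_fintype_fun_eq_card, Module.finrank_self] at this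

open Matrix in
/-- Decoupling of the quadratic form at a vector vanishing at the cut. -/
lemma form_HN_append (lam : ℝ) {N M : ℕ} (σ : Fin N → Bool) (τ : Fin M → Bool) {x : Fin N → ℝ}
    (y : Fin M → ℝ) (hx : ∀ i : Fin N, (i : ℕ) + 1 = N → x i = 0) :
    Fin.append x y ⬝ᵥ HN lam (N + M) (Fin.append σ τ) *ᵥ Fin.append x y =
      x ⬝ᵥ HN lam N σ *ᵥ x + y ⬝ᵥ HN lam M τ *ᵥ y := by
  have h11 : ∀ i j : Fin N, HN lam (N + M) (Fin.append σ τ) (Fin.castAdd M i) (Fin.castAdd M j) =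
      HN lam N σ i j := by
    intro i j
    simp [HN, Fin.ext_iff]
  have h22 : ∀ i j : Fin M, HN lam (N + M) (Fin.append σ τ) (Fin.natAdd N i) (Fin.natAdd N j) =
      HN lam M τ i j := by
    intro i j
    simp [HN, Fin.ext_iff, add_assoc]
  have h12 : ∀ (i : Fin N) (j : Fin M), x i *
      HN lam (N + M) (Fin.append σ τ) (Fin.castAdd M i) (Fin.natAdd N j) = 0 := by
    intro i j
    have hi := i.2
    by_cases h : (i : ℕ) + 1 = N
    · rw [hx i h, zero_mul]
    · have h1 : ¬ (i : ℕ) = N + j := by omega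
      have h2 : ¬ (i : ℕ) + 1 = N + j := by omega
      have h3 : ¬ N + (j : ℕ) + 1 = i := by omega
      simp [HN, Fin.ext_iff, h1, h2, h3]
  have h21 : ∀ (i : Fin N) (j : Fin M),
      HN lam (N + M) (Fin.append σ τ) (Fin.natAdd N j) (Fin.castAdd M i) * x i = 0 := by
    intro i j
    have := (isHermitian_HN lam (N + M) (Fin.append σ τ)).apply (Fin.natAdd N j) (Fin.castAdd M i)
    rw [star_trivial] at this
    rw [← this, mul_comm, h12]
  simp only [dotProduct, mulVec, Fin.sum_univ_add, Fin.append_left, Fin.append_right, h11, h22,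
    h21, mul_add, Finset.mul_sum, Finset.sum_add_distrib, Finset.sum_const_zero, mul_zero]
  simp only [← mul_assoc, h12, zero_mul, Finset.sum_const_zero, add_zero,
    zero_add]

/-- Superadditivity, up to one, of the eigenvalue counting function. -/
lemma eigCount_add_le (lam : ℝ) {N M : ℕ} (σ : Fin N → Bool) (τ : Fin M → Bool) (E : ℝ) :
    eigCount lam N σ E + eigCount lam M τ E ≤ eigCount lam (N + M) (Fin.append σ τ) E + 1 := by
  obtain ⟨T₁, hT₁, hf₁⟩ := exists_linearMap_form_le (isHermitian_HN lam N σ) E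
  obtain ⟨T₂, hT₂, hf₂⟩ := exists_linearMap_form_le (isHermitian_HN lam M τ) E
  set X₁ := {j // (isHermitian_HN lam N σ).eigenvalues j ≤ E} → ℝ
  set X₂ := {j // (isHermitian_HN lam M τ).eigenvalues j ≤ E} → ℝ
  let T : X₁ × X₂ →ₗ[ℝ] (Fin (N + M) → ℝ) :=
    { toFun := fun c => Fin.append (T₁ c.1) (T₂ c.2)
      map_add' := fun c d => by
        ext i
        refine Fin.addCases (fun i => ?_) (fun i => ?_) i <;> simp
      map_smul' := fun r c => by
        ext i
        refine Fin.addCases (fun i => ?_) (fun i => ?_) i <;> simp }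
  have hT : Function.Injective T := by
    intro c d hcd
    refine Prod.ext (hT₁ ?_) (hT₂ ?_)
    · ext i
      simpa [T] using congrFun hcd (Fin.castAdd M i)
    · ext i
      simpa [T] using congrFun hcd (Fin.natAdd N i)
  let f : X₁ × X₂ →ₗ[ℝ] ℝ := if h : 0 < N then
    (LinearMap.proj (⟨N - 1, by omega⟩ : Fin N)).comp (T₁.comp (LinearMap.fst ℝ X₁ X₂)) else 0
  have key := finrank_le_card_eigenvalues_add_one
    (isHermitian_HN lam (N + M) (Fin.append σ τ)) E T hT f (by
      intro c hc
      have hx : ∀ i : Fin N, (i : ℕ) + 1 = N → T₁ c.1 i = 0 := by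
        intro i hi
        have hN : 0 < N := i.pos
        have : i = ⟨N - 1, by omega⟩ := Fin.ext (by simp; omega)
        rw [this]
        simpa [f, hN] using hc
      have e1 : T c = Fin.append (T₁ c.1) (T₂ c.2) := rfl
      have e2 : Fin.append (T₁ c.1) (T₂ c.2) ⬝ᵥ Fin.append (T₁ c.1) (T₂ c.2) =
          T₁ c.1 ⬝ᵥ T₁ c.1 + T₂ c.2 ⬝ᵥ T₂ c.2 := by
        simp [dotProduct, Fin.sum_univ_add]
      rw [e1, form_HN_append lam σ τ _ hx, e2, mul_add]
      exact add_le_add (hf₁ _) (hf₂ _))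
  rw [Module.finrank_prod, Module.finrank_fintype_fun_eq_card,
    Module.finrank_fintype_fun_eq_card] at key
  simpa only [eigCount_eq, Fintype.card_subtype] using key

/-- The averaged eigenvalue count. -/
def meanCount (lam E : ℝ) (N : ℕ) : ℝ := (∑ σ : Fin N → Bool, (eigCount lam N σ E : ℝ)) / 2 ^ N

lemma meanCount_nonneg (lam E : ℝ) (N : ℕ) : 0 ≤ meanCount lam E N :=
  div_nonneg (Finset.sum_nonneg fun _ _ => Nat.cast_nonneg _) (by positivity)

lemma meanCount_le (lam E : ℝ) (N : ℕ) : meanCount lam E N ≤ N := by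
  rw [meanCount, div_le_iff₀ (by positivity)]
  have : ∑ σ : Fin N → Bool, (eigCount lam N σ E : ℝ) ≤ ∑ _σ : Fin N → Bool, (N : ℝ) :=
    Finset.sum_le_sum fun σ _ => by exact_mod_cast eigCount_le lam N σ E
  refine this.trans_eq ?_
  simp [mul_comm]

lemma meanCount_mono (lam : ℝ) (N : ℕ) : Monotone fun E => meanCount lam E N := by
  intro E E' h
  simp only [meanCount]
  gcongr with σ
  exact eigCount_mono lam N σ h

lemma meanCount_add_le (lam E : ℝ) (N M : ℕ) :
    meanCount lam E N + meanCount lam E M ≤ meanCount lam E (N + M) + 1 := by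
  have h1 : ∑ σ : Fin (N + M) → Bool, (eigCount lam (N + M) σ E : ℝ) =
      ∑ σ : Fin N → Bool, ∑ τ : Fin M → Bool,
        (eigCount lam (N + M) (Fin.append σ τ) E : ℝ) := by
    rw [← Fintype.sum_prod_type', ← Equiv.sum_comp (Fin.appendEquiv N M)]
    rfl
  have h2 : ∑ σ : Fin N → Bool, ∑ τ : Fin M → Bool,
      ((eigCount lam N σ E : ℝ) + eigCount lam M τ E) ≤ ∑ σ : Fin N → Bool, ∑ τ : Fin M → Bool,
        ((eigCount lam (N + M) (Fin.append σ τ) E : ℝ) + 1) :=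
    Finset.sum_le_sum fun σ _ => Finset.sum_le_sum fun τ _ => by
      exact_mod_cast eigCount_add_le lam σ τ E
  simp only [Finset.sum_add_distrib, ← h1, Finset.sum_const, Finset.card_univ,
    Fintype.card_fun, Fintype.card_fin, Fintype.card_bool, nsmul_eq_mul, ← Finset.mul_sum] at h2
  push_cast at h2
  rw [meanCount, meanCount, meanCount, pow_add]
  have hN : (0 : ℝ) < 2 ^ N := by positivity
  have hM : (0 : ℝ) < 2 ^ M := by positivity
  rw [div_add_div _ _ hN.ne' hM.ne', div_add_one (by positivity),
    div_le_div_iff_of_pos_right (by positivity)]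
  linarith

/-- The integrated density of states exists. -/
lemma exists_tendsto_meanCount_div (lam E : ℝ) :
    ∃ a, Tendsto (fun N : ℕ => meanCount lam E N / N) atTop (nhds a) := by
  have hsub : Subadditive fun N => 1 - meanCount lam E N := fun m n => by
    have := meanCount_add_le lam E m n
    simp only
    linarith
  have hbdd : BddBelow (Set.range fun N : ℕ => (1 - meanCount lam E N) / N) := by
    refine ⟨-1, ?_⟩
    rintro _ ⟨N, rfl⟩
    rcases Nat.eq_zero_or_pos N with rfl | hN
    · simp
    · have hN' : (0 : ℝ) < N := by exact_mod_cast hN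
      simp only
      rw [le_div_iff₀ hN']
      linarith [meanCount_le lam E N]
  have h := (tendsto_one_div_atTop_nhds_zero_nat (𝕜 := ℝ)).sub (hsub.tendsto_lim hbdd)
  refine ⟨_, h.congr fun N => ?_⟩
  ring

/-- Averaged Wegner-type estimate, with a boundary term. -/
lemma meanCount_sub_le {δ s l ρ E η : ℝ} (hδ : 0 < δ) (hδ1 : δ < 1) (hs : 0 < s)
    (hs1 : s < 1) (hl : 0 ≤ l) (hl1 : l ≤ 1) (hE : |E| < 2 - δ) (hρ : 0 ≤ ρ) (hρ1 : ρ < 1)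
    (hη : 0 < η) (hη1 : η ≤ 1)
    (hc : ∀ v ≠ 0, (∑ b : Bool, qform E (xfer (E + η * Complex.I - l * bval b) v) ^ (-s) *
      weight s E l (xfer (E + η * Complex.I - l * bval b) v)) ≤
        2 * ρ * (qform E v ^ (-s) * weight s E l v) ∧ |weight s E l v - 1| ≤ 1 / 2) (N : ℕ) :
    meanCount l (E + η) N - meanCount l (E - η) N ≤
      2 * η ^ s * (N * (1 + 26 * (12 / δ) / (1 - ρ)) + η⁻¹ ^ s * (12 / δ) / (1 - ρ)) := by
  choose g hg0 hgN hg hg1 hgc using fun σ : Fin N → Bool => exists_green_HN l N σ E hη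
  have hz : (E + η * Complex.I : ℂ).im = η := by simp
  have ht : ∀ b, ‖(E + η * Complex.I : ℂ) - l * bval b‖ ≤ 4 := by
    intro b
    have hb : ‖(bval b : ℂ)‖ = 1 := by cases b <;> simp [bval]
    refine (norm_sub_le _ _).trans ?_
    rw [norm_mul, hb, Complex.norm_of_nonneg hl]
    have := norm_add_le (E : ℂ) (η * Complex.I)
    rw [norm_mul, Complex.norm_I, Complex.norm_of_nonneg hη.le, Complex.norm_real,
      Real.norm_eq_abs] at this
    linarith
  have hpt : ∀ σ, (eigCount l N σ (E + η) : ℝ) - eigCount l N σ (E - η) ≤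
      2 * η ^ s * ∑ k ∈ Finset.range N, ‖g σ k (k + 1)‖ ^ s := by
    intro σ
    refine (hgc σ).trans ?_
    rw [mul_assoc, mul_assoc, Finset.mul_sum _ _ η, Finset.mul_sum _ _ (η ^ s)]
    refine mul_le_mul_of_nonneg_left ?_ (by norm_num)
    refine Finset.sum_le_sum fun k hk => ?_
    rw [← Real.mul_rpow hη.le (norm_nonneg _)]
    have h0 : 0 ≤ η * ‖g σ k (k + 1)‖ := by positivity
    have h1 := Real.rpow_le_rpow_of_exponent_ge_of_imp h0 (hg1 σ k (Finset.mem_range.1 hk)) hs1.le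
      fun _ h => absurd h one_ne_zero
    rwa [Real.rpow_one] at h1
  have hk : ∀ k ∈ Finset.range N, ∑ σ, ‖g σ k (k + 1)‖ ^ s ≤ 2 ^ N *
      (1 + 26 * (12 / δ) / (1 - ρ) + η⁻¹ ^ s * (12 / δ) * ρ ^ (N - (k + 1))) := by
    intro k hk
    have hkN := Finset.mem_range.1 hk
    have := sum_green_rpow_le hδ hδ1 hs hs1 hE hρ hρ1 (hz.symm ▸ hη : 0 < (E + η * Complex.I : ℂ).im) ht hc hkN
      (fun σ => hg0 σ k) (fun σ => hgN σ k) (fun σ => hg σ k hkN)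
    rwa [hz] at this
  have hgeo : ∑ k ∈ Finset.range N, ρ ^ (N - (k + 1)) ≤ 1 / (1 - ρ) := by
    have e : ∑ k ∈ Finset.range N, ρ ^ (N - (k + 1)) = ∑ k ∈ Finset.range N, ρ ^ k := by
      rw [← Finset.sum_range_reflect (fun k => ρ ^ k)]
      exact Finset.sum_congr rfl fun k _ => by rw [Nat.sub_sub, add_comm 1 k]
    rw [e, geom_sum_eq hρ1.ne, ← neg_div_neg_eq, neg_sub, neg_sub]
    refine div_le_div_of_nonneg_right ?_ (by linarith)
    have := pow_nonneg hρ N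
    linarith
  rw [meanCount, meanCount, ← sub_div, ← Finset.sum_sub_distrib, div_le_iff₀ (by positivity)]
  have hηs : 0 ≤ η⁻¹ ^ s := by positivity
  calc ∑ σ, ((eigCount l N σ (E + η) : ℝ) - eigCount l N σ (E - η)) ≤
      ∑ σ, 2 * η ^ s * ∑ k ∈ Finset.range N, ‖g σ k (k + 1)‖ ^ s :=
        Finset.sum_le_sum fun σ _ => hpt σ
    _ = 2 * η ^ s * ∑ k ∈ Finset.range N, ∑ σ, ‖g σ k (k + 1)‖ ^ s := by
        rw [← Finset.mul_sum, Finset.sum_comm]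
    _ ≤ 2 * η ^ s * ∑ k ∈ Finset.range N, 2 ^ N *
      (1 + 26 * (12 / δ) / (1 - ρ) + η⁻¹ ^ s * (12 / δ) * ρ ^ (N - (k + 1))) := by
        refine mul_le_mul_of_nonneg_left (Finset.sum_le_sum hk) (by positivity)
    _ = 2 * η ^ s * (2 ^ N * (N * (1 + 26 * (12 / δ) / (1 - ρ)) +
        η⁻¹ ^ s * (12 / δ) * ∑ k ∈ Finset.range N, ρ ^ (N - (k + 1)))) := by
        rw [← Finset.mul_sum, Finset.sum_add_distrib, ← Finset.mul_sum, Finset.sum_const,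
          Finset.card_range, nsmul_eq_mul]
    _ ≤ 2 * η ^ s * (2 ^ N * (N * (1 + 26 * (12 / δ) / (1 - ρ)) +
        η⁻¹ ^ s * (12 / δ) * (1 / (1 - ρ)))) := by gcongr
    _ = _ := by ring

/-- **Theorem 2.** The integrated density of states of the Anderson–Bernoulli
model at disorder `λ` exists on `{δ₀ < |E| < 2 - δ₀}` and, for every `s < 1`
and `λ` small enough (depending on `s`), is `s`-Hölder on each component of
this energy region. -/
theorem ids_holder_regularity
    (δ₀ : ℝ) (hδ₀ : 0 < δ₀) (hδ₀' : δ₀ < 1) :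
    ∀ s : ℝ, s < 1 →
      ∃ lam0 : ℝ, 0 < lam0 ∧
        ∀ lam : ℝ, 0 < lam → lam < lam0 →
          ∃ ids : ℝ → ℝ,
            (∀ E : ℝ, δ₀ < |E| → |E| < 2 - δ₀ →
              Tendsto
                (fun N : ℕ =>
                  (∑ σ : Fin N → Bool, (eigCount lam N σ E : ℝ)) / 2 ^ N / N)
                atTop (nhds (ids E))) ∧
            ∃ C : ℝ, 0 < C ∧
              ∀ E E' : ℝ, δ₀ < |E| → |E| < 2 - δ₀ → δ₀ < |E'| → |E'| < 2 - δ₀ →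
                0 < E * E' →
                |ids E - ids E'| ≤ C * |E - E'| ^ s := by
  intro s hs1
  set p := max s (1 / 2) with hp
  have hsp : s ≤ p := le_max_left _ _
  have hp0 : 0 < p := lt_of_lt_of_le (by norm_num) (le_max_right s (1 / 2))
  have hp1 : p < 1 := max_lt hs1 (by norm_num)
  obtain ⟨l₀, hl₀, hcontr⟩ := exists_contraction hδ₀ hδ₀' hp0 hp1
  refine ⟨min l₀ 1, lt_min hl₀ one_pos, fun lam hlam hlam0 => ?_⟩
  obtain ⟨hlaml, hlam1⟩ := lt_min_iff.1 hlam0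
  choose ids hids using fun E => exists_tendsto_meanCount_div lam E
  refine ⟨ids, fun E _ _ => hids E, ?_⟩
  have hmono : Monotone ids := fun E E' h => le_of_tendsto_of_tendsto' (hids E) (hids E')
    fun N => div_le_div_of_nonneg_right (meanCount_mono lam N h) N.cast_nonneg
  have hids0 : ∀ E, 0 ≤ ids E := fun E => ge_of_tendsto' (hids E)
    fun N => div_nonneg (meanCount_nonneg lam E N) N.cast_nonneg
  have hids1 : ∀ E, ids E ≤ 1 := fun E => le_of_tendsto' (hids E)
    fun N => div_le_one_of_le₀ (meanCount_le lam E N) N.cast_nonneg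
  set ρ := 1 - p * (1 - p) / 8 * lam ^ 2 with hρdef
  have hpp : 0 < p * (1 - p) := mul_pos hp0 (by linarith)
  have hlam2 : lam ^ 2 ≤ 1 := pow_le_one₀ hlam.le hlam1.le
  have hρ1 : ρ < 1 := by
    have : 0 < p * (1 - p) / 8 * lam ^ 2 := by positivity
    linarith
  have hρ : 0 ≤ ρ := by
    have h1 : p * (1 - p) ≤ 1 := mul_le_one₀ hp1.le (by linarith) (by linarith)
    have : p * (1 - p) / 8 * lam ^ 2 ≤ 1 := mul_le_one₀ (by linarith) (by positivity) hlam2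
    linarith
  set C₁ := 1 + 26 * (12 / δ₀) / (1 - ρ) with hC₁
  have hρ' : 0 < 1 - ρ := by linarith
  have hC₁0 : 0 < C₁ := by positivity
  have hlocal : ∀ E, δ₀ < |E| → |E| < 2 - δ₀ → ∀ η, 0 < η → η ≤ lam ^ 3 →
      ids (E + η) - ids (E - η) ≤ 2 * η ^ p * C₁ := by
    intro E hE1 hE2 η hη hηlam
    have hlim := (tendsto_const_div_atTop_nhds_zero_nat
      (2 * η ^ p * (η⁻¹ ^ p * (12 / δ₀) / (1 - ρ)))).const_add (2 * η ^ p * C₁)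
    rw [add_zero] at hlim
    refine le_of_tendsto_of_tendsto ((hids (E + η)).sub (hids (E - η))) hlim ?_
    filter_upwards [eventually_gt_atTop 0] with N hN
    have hN' : (0 : ℝ) < N := by exact_mod_cast hN
    have h1 := meanCount_sub_le hδ₀ hδ₀' hp0 hp1 hlam.le hlam1.le hE2 hρ hρ1 hη
      (hηlam.trans (pow_le_one₀ hlam.le hlam1.le))
      (hcontr lam hlam hlaml E hE1 hE2 η hη.le hηlam) N
    rw [← sub_div, div_le_iff₀ hN', add_mul, div_mul_cancel₀ _ hN'.ne']
    linarith
  set C₂ := 2 * C₁ + ((lam ^ 3)⁻¹) ^ p with hC₂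
  have hC₂0 : 0 < C₂ := by positivity
  have hlt : ∀ E E' : ℝ, δ₀ < |E| → |E| < 2 - δ₀ → δ₀ < |E'| → |E'| < 2 - δ₀ →
      0 < E * E' → E < E' → |ids E - ids E'| ≤ C₂ * 4 ^ (p - s) * |E - E'| ^ s := by
    intro E E' hE1 hE2 hE1' hE2' hEE hlt
    obtain ⟨x, hx⟩ : ∃ x, x = E' - E := ⟨_, rfl⟩
    have hx0 : 0 < x := by linarith
    have hx4 : x ≤ 4 := by
      have := (abs_lt.1 hE2).1
      have := (abs_lt.1 hE2').2
      linarith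
    rw [abs_sub_comm, abs_of_nonneg (sub_nonneg.2 (hmono hlt.le)), abs_sub_comm E, ← hx,
      abs_of_pos hx0]
    have hxp : ids E' - ids E ≤ C₂ * x ^ p := by
      have hx2 : x / 2 ≤ x := by linarith
      rcases le_or_gt (x / 2) (lam ^ 3) with h | h
      · have hm : δ₀ < |(E + E') / 2| ∧ |(E + E') / 2| < 2 - δ₀ := by
          rcases pos_and_pos_or_neg_and_neg_of_mul_pos hEE with ⟨h1, h2⟩ | ⟨h1, h2⟩
          · rw [abs_of_pos h1] at hE1 hE2
            rw [abs_of_pos h2] at hE1' hE2'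
            rw [abs_of_pos (by linarith)]
            constructor <;> linarith
          · rw [abs_of_neg h1] at hE1 hE2
            rw [abs_of_neg h2] at hE1' hE2'
            rw [abs_of_neg (by linarith)]
            constructor <;> linarith
        have h1 := hlocal _ hm.1 hm.2 (x / 2) (by positivity) h
        have e1 : (E + E') / 2 + x / 2 = E' := by rw [hx]; ring
        have e2 : (E + E') / 2 - x / 2 = E := by rw [hx]; ring
        rw [e1, e2] at h1
        have h2 : (x / 2) ^ p ≤ x ^ p := Real.rpow_le_rpow (by positivity) hx2 hp0.le
        calc ids E' - ids E ≤ 2 * (x / 2) ^ p * C₁ := h1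
          _ ≤ 2 * x ^ p * C₁ := by gcongr
          _ = (2 * C₁ + 0) * x ^ p := by ring
          _ ≤ C₂ * x ^ p := by
            rw [hC₂]
            gcongr
            positivity
      · have h1 : 1 ≤ ((lam ^ 3)⁻¹) ^ p * x ^ p := by
          rw [← Real.mul_rpow (by positivity) hx0.le]
          refine Real.one_le_rpow ?_ hp0.le
          rw [inv_mul_eq_div, one_le_div (by positivity)]
          linarith
        calc ids E' - ids E ≤ 1 := by linarith [hids0 E, hids1 E']
          _ ≤ ((lam ^ 3)⁻¹) ^ p * x ^ p := h1
          _ ≤ C₂ * x ^ p := by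
            rw [hC₂]
            gcongr
            linarith
    have hps : x ^ p ≤ 4 ^ (p - s) * x ^ s := by
      have : x ^ p = x ^ (p - s) * x ^ s := by rw [← Real.rpow_add hx0, sub_add_cancel]
      rw [this]
      gcongr
    calc ids E' - ids E ≤ C₂ * x ^ p := hxp
      _ ≤ C₂ * (4 ^ (p - s) * x ^ s) := by gcongr
      _ = _ := by ring
  refine ⟨C₂ * 4 ^ (p - s), by positivity, fun E E' hE1 hE2 hE1' hE2' hEE => ?_⟩
  rcases lt_trichotomy E E' with h | h | h
  · exact hlt E E' hE1 hE2 hE1' hE2' hEE h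
  · rw [h, sub_self, abs_zero]
    positivity
  · rw [abs_sub_comm, abs_sub_comm E]
    exact hlt E' E hE1' hE2' hE1 hE2 (by rwa [mul_comm]) h
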